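/- arXiv:1902.00503 — 5 statements merged into one kernel-verified Lean document; each statement's English description precedes it below -/
import Mathlib

section
/- Every factor of the infinite word x_5 has exponent at most 3/2. Precisely: for all natural numbers i, n ≥ 1 and p ≥ 1, if x_5[i+j] = x_5[i+j+p] for all j with 0 ≤ j < n − p (i.e., p is a period of the length-n factor of x_5 starting at position i), then 2n ≤ 3p. -/
/-- The characteristic Sturmian word with slope `α = √2 - 1`, indexed from 1:
`c_α[n] = ⌊α(n+1)⌋ - ⌊αn⌋`. -/
noncomputable def calpha (n : ℕ) : ℤ :=
  ⌊(Real.sqrt 2 - 1) * ((n : ℝ) + 1)⌋ - ⌊(Real.sqrt 2 - 1) * (n : ℝ)⌋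

/-- `zcount m` = number of indices `1 ≤ j ≤ m` with `c_α[j] = 0`. -/
noncomputable def zcount (m : ℕ) : ℕ :=
  ((Finset.Icc 1 m).filter fun j => calpha j = 0).card

/-- `ocount m` = number of indices `1 ≤ j ≤ m` with `c_α[j] = 1`. -/
noncomputable def ocount (m : ℕ) : ℕ :=
  ((Finset.Icc 1 m).filter fun j => calpha j = 1).card

/-- The infinite balanced word `x₅` over `{0,1,2,3,4}`, indexed from 0, obtained from
`c_α` by replacing the 0's by `(0102)^ω` and the 1's by `(34)^ω`. -/
noncomputable def x5 (i : ℕ) : ℕ :=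
  if calpha (i + 1) = 0 then [0, 1, 0, 2].getD ((zcount (i + 1) - 1) % 4) 0
  else [3, 4].getD ((ocount (i + 1) - 1) % 2) 0

/-- The slope `√2 - 1` of the Sturmian word `calpha`. -/
noncomputable def alpha : ℝ := Real.sqrt 2 - 1

lemma alpha_pos : 0 < alpha := by
  have : (1 : ℝ) < Real.sqrt 2 := by
    rw [Real.lt_sqrt] <;> norm_num
  unfold alpha; linarith

lemma alpha_sq : alpha ^ 2 = 1 - 2 * alpha := by
  have : Real.sqrt 2 ^ 2 = 2 := Real.sq_sqrt (by norm_num)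
  unfold alpha; nlinarith

lemma alpha_bounds : 2 / 5 < alpha ∧ alpha < 3 / 7 := by
  have h := alpha_sq
  have h0 := alpha_pos
  constructor <;> nlinarith

/-- The number of ones among the first `m - 1` letters of `calpha`. -/
noncomputable def beatty (m : ℕ) : ℤ := ⌊alpha * (m : ℝ)⌋

lemma calpha_eq (m : ℕ) : calpha m = beatty (m + 1) - beatty m := by
  simp [calpha, beatty, alpha]

lemma beatty_one : beatty 1 = 0 := by
  have := alpha_bounds
  rw [beatty, Int.floor_eq_iff]
  constructor <;> push_cast <;> linarith

lemma le_beatty_add {a : ℤ} {j : ℕ} (h : (a : ℝ) ≤ alpha * j) (m : ℕ) :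
    beatty m + a ≤ beatty (m + j) := by
  have := Int.floor_le (alpha * (m : ℝ))
  unfold beatty
  rw [Int.le_floor]
  push_cast
  linarith

lemma beatty_add_le {a : ℤ} {j : ℕ} (h : alpha * j ≤ (a : ℝ)) (m : ℕ) :
    beatty (m + j) ≤ beatty m + a := by
  have := Int.lt_floor_add_one (alpha * (m : ℝ))
  unfold beatty
  rw [← Int.lt_add_one_iff, Int.floor_lt]
  push_cast
  linarith

lemma beatty_local (m : ℕ) :
    beatty m ≤ beatty (m + 1) ∧ beatty (m + 1) ≤ beatty m + 1 ∧
    beatty (m + 2) ≤ beatty m + 1 ∧ beatty m + 1 ≤ beatty (m + 3) ∧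
    beatty m + 2 ≤ beatty (m + 5) ∧ beatty (m + 7) ≤ beatty m + 3 := by
  obtain ⟨h1, h2⟩ := alpha_bounds
  refine ⟨?_, ?_, ?_, ?_, ?_, ?_⟩
  · simpa using le_beatty_add (a := 0) (j := 1) (by push_cast; linarith) m
  · exact beatty_add_le (a := 1) (j := 1) (by push_cast; linarith) m
  · exact beatty_add_le (a := 1) (j := 2) (by push_cast; linarith) m
  · exact le_beatty_add (a := 1) (j := 3) (by push_cast; linarith) m
  · exact le_beatty_add (a := 2) (j := 5) (by push_cast; linarith) m
  · exact beatty_add_le (a := 3) (j := 7) (by push_cast; linarith) m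

lemma ocount_eq (m : ℕ) : (ocount m : ℤ) = beatty (m + 1) := by
  induction m with
  | zero => simp [ocount, beatty_one]
  | succ m ih =>
    have hc := calpha_eq (m + 1)
    obtain ⟨h1, h2, -⟩ := beatty_local (m + 1)
    unfold ocount at ih ⊢
    rw [← Finset.insert_Icc_right_eq_Icc_add_one (by omega), Finset.filter_insert]
    split_ifs with h
    · rw [Finset.card_insert_of_notMem (by simp)]
      push_cast
      omega
    · omega

lemma zcount_eq (m : ℕ) : (zcount m : ℤ) = m - beatty (m + 1) := by
  induction m with
  | zero => simp [zcount, beatty_one]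
  | succ m ih =>
    have hc := calpha_eq (m + 1)
    obtain ⟨h1, h2, -⟩ := beatty_local (m + 1)
    unfold zcount at ih ⊢
    rw [← Finset.insert_Icc_right_eq_Icc_add_one (by omega), Finset.filter_insert]
    split_ifs with h
    · rw [Finset.card_insert_of_notMem (by simp)]
      push_cast
      omega
    · push_cast
      omega

lemma x5_cases (i : ℕ) :
    (beatty (i + 2) = beatty (i + 1) ∧
      ((x5 i = 0 ∧ (i - beatty (i + 2)) % 2 = 0) ∨
        (x5 i = 1 ∧ (i - beatty (i + 2)) % 4 = 1) ∨
        (x5 i = 2 ∧ (i - beatty (i + 2)) % 4 = 3))) ∨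
    (beatty (i + 2) = beatty (i + 1) + 1 ∧
      ((x5 i = 3 ∧ beatty (i + 2) % 2 = 1) ∨ (x5 i = 4 ∧ beatty (i + 2) % 2 = 0))) := by
  have hc := calpha_eq (i + 1)
  have hz := zcount_eq (i + 1)
  have hz' := zcount_eq i
  have ho := ocount_eq (i + 1)
  have ho' := ocount_eq i
  obtain ⟨h1, h2, -⟩ := beatty_local (i + 1)
  simp only [add_assoc, Nat.reduceAdd] at *
  unfold x5
  split_ifs with h
  · left
    refine ⟨by omega, ?_⟩
    have : (zcount (i + 1) - 1) % 4 < 4 := Nat.mod_lt _ (by norm_num)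
    generalize hr : (zcount (i + 1) - 1) % 4 = r at *
    interval_cases r <;> simp <;> omega
  · right
    refine ⟨by omega, ?_⟩
    have : (ocount (i + 1) - 1) % 2 < 2 := Nat.mod_lt _ (by norm_num)
    generalize hr : (ocount (i + 1) - 1) % 2 = r at *
    interval_cases r <;> simp <;> omega

/-- What an equality of two letters of `x5` says about the counts of zeros and ones. -/
lemma beatty_of_x5_eq {i k : ℕ} (h : x5 i = x5 k) :
    beatty (i + 2) - beatty (i + 1) = beatty (k + 2) - beatty (k + 1) ∧
    (beatty (i + 2) = beatty (i + 1) →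
      (i - beatty (i + 2)) % 4 = (k - beatty (k + 2)) % 4 ∨
        ((i - beatty (i + 2)) % 2 = 0 ∧ (k - beatty (k + 2)) % 2 = 0)) ∧
    (beatty (i + 2) = beatty (i + 1) + 1 → beatty (i + 2) % 2 = beatty (k + 2) % 2) := by
  have h1 := x5_cases i
  have h2 := x5_cases k
  omega

/-- The Pell numbers. -/
def pell : ℕ → ℕ
  | 0 => 0
  | 1 => 1
  | n + 2 => 2 * pell (n + 1) + pell n

lemma pell_succ_pos (n : ℕ) : 0 < pell (n + 1) := by
  induction n with
  | zero => simp [pell]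
  | succ n ih => rw [pell]; omega

lemma pell_le_succ (n : ℕ) : pell n ≤ pell (n + 1) := by
  cases n with
  | zero => simp [pell]
  | succ n => rw [pell.eq_3]; omega

lemma le_pell (n : ℕ) : n ≤ pell n := by
  induction n with
  | zero => simp
  | succ n ih =>
    cases n with
    | zero => simp [pell]
    | succ n =>
      have := pell_succ_pos n
      rw [pell]; omega

lemma alpha_mul_pell (n : ℕ) :
    alpha * pell (n + 1) - pell n = (-1) ^ n * alpha ^ (n + 1) := by
  induction n with
  | zero => simp [pell]
  | succ n ih =>
    have h : alpha * ((-1) ^ n * alpha ^ (n + 1)) = (-1) ^ n * alpha ^ (n + 2) := by ring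
    have hs := alpha_sq
    rw [← ih] at h
    rw [pell, show (-1 : ℝ) ^ (n + 1) * alpha ^ (n + 1 + 1) = -((-1) ^ n * alpha ^ (n + 2)) by ring,
      ← h]
    push_cast
    linear_combination (pell (n + 1) : ℝ) * hs

/-- Every orbit segment of `pell (n + 1) + pell n` points of the rotation by `alpha` meets every
half-open arc of length `alpha ^ n`. -/
lemma exists_orbit_mem (n : ℕ) (x : ℝ) :
    ∃ j : ℕ, j < pell (n + 1) + pell n ∧ ∃ z : ℤ,
      (z : ℝ) ≤ x + alpha * j ∧ x + alpha * j < z + alpha ^ n := by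
  induction n generalizing x with
  | zero =>
    refine ⟨0, by simp [pell], ⌊x⌋, ?_, ?_⟩
    · simp [Int.floor_le x]
    · simp
  | succ n ih =>
    have hs : alpha ^ n = 2 * alpha ^ (n + 1) + alpha ^ (n + 2) := by
      have := alpha_sq
      linear_combination (-alpha ^ n) * this
    have hp1 : 0 < alpha ^ (n + 1) := pow_pos alpha_pos _
    have hp2 : 0 < alpha ^ (n + 2) := pow_pos alpha_pos _
    have hlt : alpha ^ (n + 2) < alpha ^ (n + 1) :=
      pow_lt_pow_right_of_lt_one₀ alpha_pos (by linarith [alpha_bounds.2]) (by omega)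
    have hD := alpha_mul_pell n
    have hpell : pell (n + 2) = 2 * pell (n + 1) + pell n := rfl
    have key : ∀ (j : ℕ) (z : ℤ) (t : ℕ), t ≤ 2 → j < pell (n + 1) + pell n →
        (z : ℝ) ≤ x + alpha * j + t * ((-1) ^ n * alpha ^ (n + 1)) →
        x + alpha * j + t * ((-1) ^ n * alpha ^ (n + 1)) < z + alpha ^ (n + 1) →
        ∃ j : ℕ, j < pell (n + 1 + 1) + pell (n + 1) ∧ ∃ z : ℤ,
          (z : ℝ) ≤ x + alpha * j ∧ x + alpha * j < z + alpha ^ (n + 1) := by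
      intro j z t ht hj h1 h2
      refine ⟨j + t * pell (n + 1), ?_, z + t * pell n, ?_, ?_⟩
      · have := Nat.mul_le_mul_right (pell (n + 1)) ht
        rw [show n + 1 + 1 = n + 2 from rfl, hpell]
        omega
      · rw [← hD] at h1
        push_cast
        linarith
      · rw [← hD] at h2
        push_cast
        linarith
    rcases neg_one_pow_eq_or ℝ n with h | h <;> simp only [h] at key
    · obtain ⟨j, hj, z, h1, h2⟩ := ih (x + alpha ^ (n + 1) + alpha ^ (n + 2))
      by_cases c0 : (z : ℝ) ≤ x + alpha * j
      · exact key j z 0 (by norm_num) hj (by push_cast; linarith) (by push_cast; linarith)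
      by_cases c1 : (z : ℝ) ≤ x + alpha * j + alpha ^ (n + 1)
      · exact key j z 1 (by norm_num) hj (by push_cast; linarith) (by push_cast; linarith)
      · exact key j z 2 (by norm_num) hj (by push_cast; linarith) (by push_cast; linarith)
    · obtain ⟨j, hj, z, h1, h2⟩ := ih x
      by_cases c0 : x + alpha * j < z + alpha ^ (n + 1)
      · exact key j z 0 (by norm_num) hj (by push_cast; linarith) (by push_cast; linarith)
      by_cases c1 : x + alpha * j < z + 2 * alpha ^ (n + 1)
      · exact key j z 1 (by norm_num) hj (by push_cast; linarith) (by push_cast; linarith)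
      · exact key j z 2 (by norm_num) hj (by push_cast; linarith) (by push_cast; linarith)

/-- Coordinates of an integer vector in the basis of two consecutive convergents of `alpha`. -/
lemma exists_pell_coords (n : ℕ) (p b : ℤ) :
    ∃ u v : ℤ, p = u * pell (n + 1) + v * pell (n + 2) ∧
      b = u * pell n + v * pell (n + 1) ∧ (u + v) % 2 = (p - b) % 2 := by
  induction n with
  | zero => exact ⟨p - 2 * b, b, by simp [pell]; ring, by simp [pell], by omega⟩
  | succ n ih =>
    obtain ⟨u, v, h1, h2, h3⟩ := ih
    have e1 : pell (n + 3) = 2 * pell (n + 2) + pell (n + 1) := rfl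
    have e2 : pell (n + 2) = 2 * pell (n + 1) + pell n := rfl
    refine ⟨v - 2 * u, u, ?_, ?_, by omega⟩
    · rw [h1, show n + 1 + 2 = n + 3 from rfl, e1]
      push_cast
      ring
    · rw [h2, show n + 1 + 1 = n + 2 from rfl, e2]
      push_cast
      ring

/-- Rational approximations of `alpha` with numerator and denominator of the same parity
are poor. -/
lemma alpha_pow_le_abs {n : ℕ} {p b : ℤ} (hp : 0 < p)
    (hpn : p < pell (n + 2) + pell (n + 1)) (hpar : (p - b) % 2 = 0) :
    alpha ^ n ≤ 2 * |alpha * p - b| := by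
  obtain ⟨u, v, h1, h2, h3⟩ := exists_pell_coords n p b
  have hq1 : (0 : ℤ) < pell (n + 1) := by exact_mod_cast pell_succ_pos n
  have hq2 : (pell (n + 1) : ℤ) ≤ pell (n + 2) := by exact_mod_cast pell_le_succ (n + 1)
  have hs := alpha_bounds
  have hsq := alpha_sq
  have hD : alpha * p - b = (-1) ^ n * alpha ^ (n + 1) * (u - alpha * v) := by
    have e1 := alpha_mul_pell n
    have e2 := alpha_mul_pell (n + 1)
    rw [h1, h2]
    push_cast
    linear_combination (u : ℝ) * e1 + (v : ℝ) * e2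
  have key : 1 + alpha / 2 ≤ |(u : ℝ) - alpha * v| := by
    rcases lt_trichotomy v 0 with hv | hv | hv
    · have hu : 1 ≤ u := by
        by_contra! hu
        nlinarith
      have hu' : (1 : ℝ) ≤ u := by exact_mod_cast hu
      have hv' : (v : ℝ) ≤ -1 := by exact_mod_cast (by omega : v ≤ -1)
      exact le_trans (by nlinarith) (le_abs_self _)
    · have hu : 1 ≤ u := by
        by_contra! hu
        subst hv
        nlinarith
      have hu' : (2 : ℝ) ≤ u := by exact_mod_cast (by omega : 2 ≤ u)
      subst hv
      exact le_trans (by push_cast; nlinarith) (le_abs_self _)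
    · have hu : u ≤ -1 := by
        by_contra! hu
        rcases (by omega : u = 0 ∨ 1 ≤ u) with hu0 | hu1
        · subst hu0
          have : 2 ≤ v := by omega
          nlinarith
        · nlinarith
      have hu' : (u : ℝ) ≤ -1 := by exact_mod_cast hu
      have hv' : (1 : ℝ) ≤ v := by exact_mod_cast (by omega : 1 ≤ v)
      exact le_trans (by nlinarith) (neg_le_abs _)
  have hpos : 0 < alpha ^ n := pow_pos alpha_pos n
  rw [hD, abs_mul, abs_mul, abs_pow, abs_neg, abs_one, one_pow, one_mul,
    abs_of_pos (pow_pos alpha_pos _)]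
  calc alpha ^ n = 2 * (alpha ^ (n + 1) * (1 + alpha / 2)) := by
        linear_combination (-alpha ^ n) * hsq
    _ ≤ _ := by
        have := mul_le_mul_of_nonneg_left key (pow_pos alpha_pos (n + 1)).le
        linarith

lemma exists_pell_window {p : ℕ} (hp : 1 ≤ p) :
    ∃ n, pell (n + 1) + pell n ≤ p ∧ p < pell (n + 2) + pell (n + 1) := by
  have hex : ∃ n, p < pell (n + 1) + pell n := ⟨p, by have := le_pell (p + 1); omega⟩
  have hspec := Nat.find_spec hex
  have hmin := fun m => Nat.find_min hex (m := m)
  generalize Nat.find hex = k at *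
  cases k with
  | zero => simp [pell] at hspec; omega
  | succ n => exact ⟨n, by simpa using hmin n (by omega), hspec⟩

/-- Over a window of more than `p` shifts, the number of ones in blocks of length `2 * p` cannot be
constantly `2 * b` when `p` and `b` have the same parity. -/
lemma not_forall_beatty_eq {p m : ℕ} {b : ℤ} (hp : 1 ≤ p) (hpar : ((p : ℤ) - b) % 2 = 0)
    (h : ∀ j ≤ p, beatty (m + j + 2 * p) = beatty (m + j) + 2 * b) : False := by
  obtain ⟨n, hn1, hn2⟩ := exists_pell_window hp
  have hab := alpha_pow_le_abs (n := n) (p := p) (b := b) (by omega) (by omega) hpar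
  push_cast at hab
  rcases le_total 0 (alpha * p - b) with hd | hd
  · rw [abs_of_nonneg hd] at hab
    obtain ⟨j, hj, z, h1, h2⟩ := exists_orbit_mem n (alpha * m + alpha ^ n)
    have hjp := h j (by omega)
    have hlo : beatty (m + j) < z := by
      rw [beatty, Int.floor_lt]; push_cast; linarith
    have hhi : z + 2 * b ≤ beatty (m + j + 2 * p) := by
      rw [beatty, Int.le_floor]; push_cast; linarith
    omega
  · rw [abs_of_nonpos hd] at hab
    obtain ⟨j, hj, z, h1, h2⟩ := exists_orbit_mem n (alpha * m)
    have hjp := h j (by omega)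
    have hlo : z ≤ beatty (m + j) := by
      rw [beatty, Int.le_floor]; push_cast; linarith
    have hhi : beatty (m + j + 2 * p) < z + 2 * b := by
      rw [beatty, Int.floor_lt]; push_cast; linarith
    omega

lemma not_short_period {i p : ℕ} (hp : 1 ≤ p) (hp5 : p ≤ 5)
    (h : ∀ j, 2 * j ≤ p → x5 (i + j) = x5 (i + j + p)) : False := by
  have b1 := beatty_local (i + 1)
  have b2 := beatty_local (i + 2)
  have b3 := beatty_local (i + 3)
  have b4 := beatty_local (i + 4)
  have b5 := beatty_local (i + 5)
  have b6 := beatty_local (i + 6)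
  have b7 := beatty_local (i + 7)
  have b8 := beatty_local (i + 8)
  have e0 := beatty_of_x5_eq (h 0 (by omega))
  have e1 := fun hh => beatty_of_x5_eq (h 1 hh)
  have e2 := fun hh => beatty_of_x5_eq (h 2 hh)
  interval_cases p <;> simp [add_assoc] at * <;> omega

/-- A repetition of four letters determines the counts of zeros modulo 4 and of ones modulo 2. -/
lemma beatty_shift_mod {i p : ℕ} (h : ∀ j, j < 4 → x5 (i + j) = x5 (i + j + p)) :
    (beatty (i + 1 + p) - beatty (i + 1)) % 2 = 0 ∧
      (p - (beatty (i + 1 + p) - beatty (i + 1))) % 4 = 0 := by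
  have b1 := beatty_local (i + 1)
  have b2 := beatty_local (i + 2)
  have b3 := beatty_local (i + 3)
  have b4 := beatty_local (i + 4)
  have e0 := beatty_of_x5_eq (h 0 (by omega))
  have e1 := beatty_of_x5_eq (h 1 (by omega))
  have e2 := beatty_of_x5_eq (h 2 (by omega))
  have e3 := beatty_of_x5_eq (h 3 (by omega))
  simp only [add_zero, add_right_comm i _ p] at *
  simp only [add_assoc, Nat.reduceAdd] at *
  simp only [add_comm p] at *
  push_cast at *
  omega

/-- Every factor of `x₅` has exponent at most `3/2`: if the length-`n` factor of `x₅`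
starting at position `i` has period `p ≥ 1`, then `2n ≤ 3p`. -/
theorem x5_critical_exponent_le (i n p : ℕ) (hn : 1 ≤ n) (hp : 1 ≤ p)
    (hper : ∀ j, j + p < n → x5 (i + j) = x5 (i + j + p)) :
    2 * n ≤ 3 * p := by
  by_contra! hlt
  rcases le_or_gt p 5 with hp5 | hp5
  · exact not_short_period hp hp5 fun j hj => hper j (by omega)
  obtain ⟨hb, hz⟩ := beatty_shift_mod (i := i) (p := p) fun j hj => hper j (by omega)
  obtain ⟨b, hb⟩ : ∃ b, beatty (i + 1 + p) - beatty (i + 1) = 2 * b :=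
    ⟨_, (Int.mul_ediv_cancel' (Int.dvd_of_emod_eq_zero hb)).symm⟩
  obtain ⟨q, rfl⟩ : ∃ q, p = 2 * q := ⟨p / 2, by omega⟩
  refine not_forall_beatty_eq (p := q) (m := i + 1) (b := b) (by omega) (by omega) fun j => ?_
  induction j with
  | zero => intro _; simp only [add_zero]; omega
  | succ j ih =>
    intro hj
    have h1 := ih (by omega)
    have h2 := (beatty_of_x5_eq (hper j (by omega))).1
    rw [show i + 1 + (j + 1) + 2 * q = i + j + 2 * q + 2 by ring,
      show i + 1 + (j + 1) = i + j + 2 by ring]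
    rw [show i + 1 + j + 2 * q = i + j + 2 * q + 1 by ring,
      show i + 1 + j = i + j + 1 by ring] at h1
    omega
end

section
/- The critical exponent of the infinite word x_5 equals 3/2: the supremum, over all positions i, lengths n ≥ 1 and periods p ≥ 1 such that x_5[i+j] = x_5[i+j+p] for all 0 ≤ j < n − p, of the rational numbers n/p is exactly 3/2, and this supremum is attained by some factor. -/
namespace X5

/-- The slope `√2 - 1`. -/
noncomputable def slope : ℝ := Real.sqrt 2 - 1

lemma slope_sq : slope * slope = 1 - 2 * slope := by
  have h : Real.sqrt 2 * Real.sqrt 2 = 2 := Real.mul_self_sqrt (by norm_num)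
  unfold slope
  linarith

lemma slope_nonneg : 0 ≤ slope := by
  have : (1 : ℝ) ≤ Real.sqrt 2 := Real.one_le_sqrt.2 (by norm_num)
  unfold slope
  linarith

lemma slope_gt : (0.4142 : ℝ) < slope := by
  nlinarith [slope_sq, slope_nonneg]

lemma slope_lt : slope < (0.41425 : ℝ) := by
  nlinarith [slope_sq, slope_nonneg]

/-- The mechanical sequence `⌊α n⌋`. -/
noncomputable def mech (n : ℕ) : ℤ := ⌊slope * (n : ℝ)⌋

lemma mech_eq {n : ℕ} {z : ℤ} (h₁ : (z : ℝ) ≤ slope * n) (h₂ : slope * n < z + 1) :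
    mech n = z := Int.floor_eq_iff.2 ⟨h₁, h₂⟩

lemma calpha_eq (n : ℕ) : calpha n = mech (n + 1) - mech n := by
  simp [calpha, mech, slope]

lemma mech_add_bounds (n d : ℕ) (lo hi : ℤ) (h₁ : (lo : ℝ) ≤ slope * d)
    (h₂ : slope * d ≤ hi) : lo ≤ mech (n + d) - mech n ∧ mech (n + d) - mech n ≤ hi := by
  have a₁ := Int.floor_le (slope * (n : ℝ))
  have a₂ := Int.lt_floor_add_one (slope * (n : ℝ))
  have b₁ := Int.floor_le (slope * ((n + d : ℕ) : ℝ))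
  have b₂ := Int.lt_floor_add_one (slope * ((n + d : ℕ) : ℝ))
  change ((mech n : ℤ) : ℝ) ≤ _ at a₁
  change _ < ((mech n : ℤ) : ℝ) + 1 at a₂
  change ((mech (n + d) : ℤ) : ℝ) ≤ _ at b₁
  change _ < ((mech (n + d) : ℤ) : ℝ) + 1 at b₂
  push_cast at b₁ b₂
  constructor
  · have : (lo : ℝ) < ((mech (n + d) - mech n + 1 : ℤ) : ℝ) := by push_cast; linarith
    have := Int.cast_lt.1 this
    omega
  · have : ((mech (n + d) - mech n - 1 : ℤ) : ℝ) < (hi : ℝ) := by push_cast; linarith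
    have := Int.cast_lt.1 this
    omega

lemma mech_succ (n : ℕ) : 0 ≤ mech (n + 1) - mech n ∧ mech (n + 1) - mech n ≤ 1 :=
  mech_add_bounds n 1 0 1 (by norm_num; linarith [slope_gt]) (by norm_num; linarith [slope_lt])

lemma mech_add_two (n : ℕ) : 0 ≤ mech (n + 2) - mech n ∧ mech (n + 2) - mech n ≤ 1 :=
  mech_add_bounds n 2 0 1 (by norm_num; linarith [slope_gt]) (by norm_num; linarith [slope_lt])

lemma mech_add_three (n : ℕ) : 1 ≤ mech (n + 3) - mech n ∧ mech (n + 3) - mech n ≤ 2 :=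
  mech_add_bounds n 3 1 2 (by norm_num; linarith [slope_gt]) (by norm_num; linarith [slope_lt])

lemma mech_add_seven (n : ℕ) : 2 ≤ mech (n + 7) - mech n ∧ mech (n + 7) - mech n ≤ 3 :=
  mech_add_bounds n 7 2 3 (by norm_num; linarith [slope_gt]) (by norm_num; linarith [slope_lt])

lemma mech_one : mech 1 = 0 :=
  mech_eq (by norm_num; linarith [slope_gt]) (by norm_num; linarith [slope_lt])

lemma counts (m : ℕ) :
    (ocount m : ℤ) = mech (m + 1) ∧ (zcount m : ℤ) = m - mech (m + 1) := by
  induction m with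
  | zero => simp [ocount, zcount, mech_one]
  | succ m ih =>
    have hI : Finset.Icc 1 (m + 1) = insert (m + 1) (Finset.Icc 1 m) := by
      ext j; simp; omega
    have hm := mech_succ (m + 1)
    have hc := calpha_eq (m + 1)
    have hne : m + 1 ∉ Finset.Icc 1 m := by simp
    have hd : calpha (m + 1) = 0 ∨ calpha (m + 1) = 1 := by omega
    unfold ocount zcount at *
    rw [hI, Finset.filter_insert, Finset.filter_insert]
    rcases hd with h | h
    · rw [if_neg (by omega), if_pos h, Finset.card_insert_of_notMem (by simp)]
      push_cast
      omega
    · rw [if_pos h, if_neg (by omega), Finset.card_insert_of_notMem (by simp)]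
      push_cast
      omega

lemma x5_of_zero {i : ℕ} (h : mech (i + 2) = mech (i + 1)) :
    x5 i = [0, 1, 0, 2].getD (((i - mech (i + 1)) % 4).toNat) 0 := by
  have hc := calpha_eq (i + 1)
  have hz := (counts (i + 1)).2
  have h0 : calpha (i + 1) = 0 := by
    have : i + 1 + 1 = i + 2 := rfl
    rw [this] at hc; omega
  have hpos : 1 ≤ zcount (i + 1) := by
    unfold zcount
    exact Finset.card_pos.2 ⟨i + 1, by simp [h0]⟩
  unfold x5
  rw [if_pos h0]
  congr 1
  have : i + 1 + 1 = i + 2 := rfl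
  rw [this] at hz
  omega

lemma x5_of_one {i : ℕ} (h : mech (i + 2) ≠ mech (i + 1)) :
    x5 i = [3, 4].getD ((mech (i + 1) % 2).toNat) 0 := by
  have hc := calpha_eq (i + 1)
  have hz := (counts (i + 1)).1
  have hs := mech_succ (i + 1)
  have e : i + 1 + 1 = i + 2 := rfl
  rw [e] at hc hz hs
  have h0 : calpha (i + 1) ≠ 0 := by omega
  have hpos : 1 ≤ ocount (i + 1) := by
    unfold ocount
    exact Finset.card_pos.2 ⟨i + 1, by simp; omega⟩
  unfold x5
  rw [if_neg h0]
  congr 1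
  omega

/-- What equality of two letters of `x₅` says about the mechanical sequence. -/
lemma x5_eq_imp {i k : ℕ} (h : x5 i = x5 k) :
    (mech (i + 2) = mech (i + 1) ∧ mech (k + 2) = mech (k + 1) ∧
      ((i - mech (i + 1)) % 4 = (k - mech (k + 1)) % 4 ∨
        (i - mech (i + 1)) % 2 = 0 ∧ (k - mech (k + 1)) % 2 = 0)) ∨
    (mech (i + 2) = mech (i + 1) + 1 ∧ mech (k + 2) = mech (k + 1) + 1 ∧
      mech (i + 1) % 2 = mech (k + 1) % 2) := by
  have hi := mech_succ (i + 1)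
  have hk := mech_succ (k + 1)
  rw [show i + 1 + 1 = i + 2 from rfl] at hi
  rw [show k + 1 + 1 = k + 2 from rfl] at hk
  have four (z : ℤ) : z % 4 = 0 ∨ z % 4 = 1 ∨ z % 4 = 2 ∨ z % 4 = 3 := by omega
  by_cases ei : mech (i + 2) = mech (i + 1) <;> by_cases ek : mech (k + 2) = mech (k + 1)
  · rw [x5_of_zero ei, x5_of_zero ek] at h
    refine Or.inl ⟨ei, ek, ?_⟩
    rcases four (i - mech (i + 1)) with a | a | a | a <;>
      rcases four (k - mech (k + 1)) with b | b | b | b <;>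
      simp [a, b] at h ⊢ <;> omega
  · rw [x5_of_zero ei, x5_of_one ek] at h
    rcases four (i - mech (i + 1)) with a | a | a | a <;>
      rcases Int.emod_two_eq_zero_or_one (mech (k + 1)) with b | b <;> simp [a, b] at h
  · rw [x5_of_one ei, x5_of_zero ek] at h
    rcases four (k - mech (k + 1)) with a | a | a | a <;>
      rcases Int.emod_two_eq_zero_or_one (mech (i + 1)) with b | b <;> simp [a, b] at h
  · rw [x5_of_one ei, x5_of_one ek] at h
    refine Or.inr ⟨by omega, by omega, ?_⟩
    rcases Int.emod_two_eq_zero_or_one (mech (i + 1)) with a | a <;>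
      rcases Int.emod_two_eq_zero_or_one (mech (k + 1)) with b | b <;> simp [a, b] at h ⊢

/-- A window of `s + t` consecutive multiples of the slope meets every half-open interval modulo
one that is no shorter than both steps `sα - u > 0` and `v - tα > 0`. -/
lemma exists_mem_window (s t : ℕ) (u v : ℤ) (k₀ N : ℕ) (A L : ℝ)
    (hs : 0 < slope * s - u) (ht : slope * t - v < 0)
    (hsL : slope * s - u ≤ L) (htL : v - slope * t ≤ L)
    (hN : s + t ≤ N) (hN' : 0 < N) :
    ∃ j < N, ∃ z : ℤ, A ≤ slope * ((k₀ + j : ℕ) : ℝ) + z ∧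
      slope * ((k₀ + j : ℕ) : ℝ) + z < A + L := by
  set δ := min (slope * s - u) (v - slope * t) with hδ
  have δpos : 0 < δ := lt_min hs (by linarith)
  have δs : δ ≤ slope * s - u := min_le_left _ _
  have δt : δ ≤ v - slope * t := min_le_right _ _
  have key (n : ℕ) : ∀ j < N, ∀ z : ℤ, slope * ((k₀ + j : ℕ) : ℝ) + z < A →
      A - (slope * ((k₀ + j : ℕ) : ℝ) + z) ≤ n * δ →
      ∃ j < N, ∃ z : ℤ, A ≤ slope * ((k₀ + j : ℕ) : ℝ) + z ∧
        slope * ((k₀ + j : ℕ) : ℝ) + z < A + L := by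
    induction n with
    | zero => intro j _ z h₁ h₂; simp at h₂ h₁; linarith
    | succ n ih =>
      intro j hj z h₁ h₂
      push_cast at h₂
      by_cases hjs : j + s < N
      · have e : slope * ((k₀ + (j + s) : ℕ) : ℝ) + ((z - u : ℤ) : ℝ) =
            slope * ((k₀ + j : ℕ) : ℝ) + z + (slope * s - u) := by push_cast; ring
        by_cases h : slope * ((k₀ + (j + s) : ℕ) : ℝ) + ((z - u : ℤ) : ℝ) < A
        · refine ih _ hjs _ h ?_
          rw [e]; push_cast at *; linarith
        · exact ⟨j + s, hjs, z - u, not_lt.1 h, by rw [e]; linarith⟩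
      · obtain ⟨l, rfl⟩ : ∃ l, j = l + t := ⟨j - t, by omega⟩
        have e : slope * ((k₀ + l : ℕ) : ℝ) + ((z + v : ℤ) : ℝ) =
            slope * ((k₀ + (l + t) : ℕ) : ℝ) + z + (v - slope * t) := by push_cast; ring
        by_cases h : slope * ((k₀ + l : ℕ) : ℝ) + ((z + v : ℤ) : ℝ) < A
        · refine ih _ (by omega) _ h ?_
          rw [e]; push_cast at *; linarith
        · exact ⟨l, by omega, z + v, not_lt.1 h, by rw [e]; linarith⟩
  obtain ⟨z, hz⟩ : ∃ z : ℤ, slope * ((k₀ + 0 : ℕ) : ℝ) + z < A := by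
    obtain ⟨z, hz⟩ := exists_int_lt (A - slope * ((k₀ + 0 : ℕ) : ℝ))
    exact ⟨z, by linarith⟩
  obtain ⟨n, hn⟩ := exists_nat_ge ((A - (slope * ((k₀ + 0 : ℕ) : ℝ) + z)) / δ)
  exact key n 0 hN' z hz ((div_le_iff₀ δpos).1 hn)

/-- If the increments of `⌊αk⌋` over `p` steps equal `q` throughout a window of `s + t` indices,
then `|pα - q|` is less than one of the two steps. -/
lemma abs_lt_of_const_increment (s t : ℕ) (u v : ℤ) (k₀ N p : ℕ) (q : ℤ) (L : ℝ)
    (hs : 0 < slope * s - u) (ht : slope * t - v < 0)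
    (hsL : slope * s - u ≤ L) (htL : v - slope * t ≤ L)
    (hN : s + t ≤ N) (hN' : 0 < N)
    (hq : ∀ j < N, mech (k₀ + j + p) - mech (k₀ + j) = q) :
    |slope * p - q| < L := by
  by_contra! hL
  rcases le_total 0 (slope * p - q) with h | h
  · rw [abs_of_nonneg h] at hL
    obtain ⟨j, hj, z, h₁, h₂⟩ := exists_mem_window s t u v k₀ N (-(slope * p - q)) (slope * p - q)
      hs ht (hsL.trans hL) (htL.trans hL) hN hN'
    have a : mech (k₀ + j) < -z := Int.floor_lt.2 (by push_cast at *; linarith)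
    have b : q - z ≤ mech (k₀ + j + p) := Int.le_floor.2 (by push_cast at *; linarith)
    have := hq j hj
    omega
  · rw [abs_of_nonpos h] at hL
    obtain ⟨j, hj, z, h₁, h₂⟩ := exists_mem_window s t u v k₀ N 0 (-(slope * p - q))
      hs ht (hsL.trans hL) (htL.trans hL) hN hN'
    have a : -z ≤ mech (k₀ + j) := Int.le_floor.2 (by push_cast at *; linarith)
    have b : mech (k₀ + j + p) < q - z := Int.floor_lt.2 (by push_cast at *; linarith)
    have := hq j hj
    omega

/-- Pell numbers: denominators of the convergents of the slope. -/
def pell : ℕ → ℕ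
  | 0 => 0
  | 1 => 1
  | n + 2 => 2 * pell (n + 1) + pell n

/-- Numerators matching the denominators `pell`. -/
def pellNum : ℕ → ℤ
  | 0 => 1
  | 1 => 0
  | n + 2 => 2 * pellNum (n + 1) + pellNum n

/-- The signed approximation error of a convergent. -/
noncomputable def err (k : ℕ) : ℝ := slope * pell k - pellNum k

lemma err_succ (k : ℕ) : err (k + 1) = -slope * err k := by
  induction k with
  | zero => simp [err, pell, pellNum]
  | succ k ih =>
    have h : err (k + 2) = 2 * err (k + 1) + err k := by
      simp only [err, pell, pellNum]; push_cast; ring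
    rw [h, ih]
    linear_combination (-err k) * slope_sq

lemma err_ne_zero (k : ℕ) : err k ≠ 0 := by
  induction k with
  | zero => simp [err, pell, pellNum]
  | succ k ih =>
    rw [err_succ]
    exact mul_ne_zero (by linarith [slope_gt]) ih

lemma pell_add_pellNum_odd (k : ℕ) :
    ((pell k : ℤ) + pellNum k) % 2 = 1 ∧ ((pell (k + 1) : ℤ) + pellNum (k + 1)) % 2 = 1 := by
  induction k with
  | zero => simp [pell, pellNum]
  | succ k ih =>
    refine ⟨ih.2, ?_⟩
    simp only [pell, pellNum] at *
    push_cast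
    omega

lemma pell_succ_pos (k : ℕ) : 0 < pell (k + 1) := by
  induction k with
  | zero => simp [pell]
  | succ k ih => simp only [pell] at *; omega

lemma exists_pell_coords (k : ℕ) (a b : ℤ) :
    ∃ x y : ℤ, a = x * pell (k + 1) + y * pell k ∧ b = x * pellNum (k + 1) + y * pellNum k := by
  induction k with
  | zero => exact ⟨a, b, by simp [pell], by simp [pellNum]⟩
  | succ k ih =>
    obtain ⟨x, y, h₁, h₂⟩ := ih
    refine ⟨y, x - 2 * y, ?_, ?_⟩
    · rw [h₁]; simp only [pell]; push_cast; ring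
    · rw [h₂]; simp only [pellNum]; ring

/-- Every positive integer lies in one of the ranges cut out by consecutive Pell numbers and
their sums. -/
lemma exists_pell_range (N : ℕ) (hN : 0 < N) :
    ∃ k, pell (k + 1) + pell k ≤ N ∧ N < pell (k + 2) + pell (k + 1) := by
  have hmono : ∀ n, n < pell (n + 1) + pell n := by
    intro n
    induction n with
    | zero => simp [pell]
    | succ n ih =>
      have := pell_succ_pos n
      simp only [pell]; omega
  have hex : ∃ k, N < pell (k + 1) + pell k := ⟨N, hmono N⟩
  classical
  have hspec := Nat.find_spec hex
  have hpos : Nat.find hex ≠ 0 := by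
    intro h
    rw [h] at hspec
    simp [pell] at hspec
    omega
  obtain ⟨k, hk⟩ := Nat.exists_eq_succ_of_ne_zero hpos
  refine ⟨k, ?_, ?_⟩
  · have := Nat.find_min hex (m := k) (by omega)
    omega
  · rw [hk] at hspec
    exact hspec

/-- Two consecutive errors bound the deviation of a long constant increment. -/
lemma abs_lt_err (k k₀ N p : ℕ) (q : ℤ) (hN : pell (k + 1) + pell k ≤ N)
    (hq : ∀ j < N, mech (k₀ + j + p) - mech (k₀ + j) = q) :
    |slope * p - q| < |err k| := by
  have hpos := pell_succ_pos k
  have hs := err_succ k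
  have g := slope_gt
  have l := slope_lt
  rcases lt_or_gt_of_ne (err_ne_zero k) with h | h
  · rw [abs_of_neg h]
    apply abs_lt_of_const_increment (pell (k + 1)) (pell k) (pellNum (k + 1)) (pellNum k)
      k₀ N p q _ _ _ _ _ hN (by omega) hq
    all_goals unfold err at *; nlinarith
  · rw [abs_of_pos h]
    apply abs_lt_of_const_increment (pell k) (pell (k + 1)) (pellNum k) (pellNum (k + 1))
      k₀ N p q _ _ _ _ _ (by omega) (by omega) hq
    all_goals unfold err at *; nlinarith

/-- A refinement of `abs_lt_err` for windows reaching the next Pell number. -/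
lemma abs_lt_err_mul (k k₀ N p : ℕ) (q : ℤ) (hN : pell (k + 2) ≤ N)
    (hq : ∀ j < N, mech (k₀ + j + p) - mech (k₀ + j) = q) :
    |slope * p - q| < (1 - slope) * |err k| := by
  have hpos := pell_succ_pos k
  have hs := err_succ k
  have g := slope_gt
  have l := slope_lt
  simp only [pell] at hN
  rcases lt_or_gt_of_ne (err_ne_zero k) with h | h
  · rw [abs_of_neg h]
    apply abs_lt_of_const_increment (pell (k + 1)) (pell (k + 1) + pell k)
      (pellNum (k + 1)) (pellNum (k + 1) + pellNum k) k₀ N p q _ _ _ _ _ (by omega) (by omega) hq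
    all_goals unfold err at *; push_cast; nlinarith
  · rw [abs_of_pos h]
    apply abs_lt_of_const_increment (pell (k + 1) + pell k) (pell (k + 1))
      (pellNum (k + 1) + pellNum k) (pellNum (k + 1)) k₀ N p q _ _ _ _ _ (by omega) (by omega) hq
    all_goals unfold err at *; push_cast; nlinarith

/-- No increment `2b` over `2a` steps, with `a + b` even, is constant on a window of `a + 2`
indices. -/
lemma not_const_increment (k₀ a : ℕ) (b : ℤ) (ha : 0 < a) (hab : ((a : ℤ) + b) % 2 = 0)
    (hq : ∀ j < a + 2, mech (k₀ + j + 2 * a) - mech (k₀ + j) = 2 * b) : False := by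
  obtain ⟨k, hk₁, hk₂⟩ := exists_pell_range (a + 2) (by omega)
  obtain ⟨x, y, hx, hy⟩ := exists_pell_coords k a b
  have hpos := pell_succ_pos k
  have g := slope_gt
  have l := slope_lt
  have hE : 0 < |err k| := abs_pos.2 (err_ne_zero k)
  have hxy : (x + y) % 2 = 0 := by
    have := pell_add_pellNum_odd k
    have e : (a : ℤ) + b = x * (pell (k + 1) + pellNum (k + 1)) + y * (pell k + pellNum k) := by
      rw [hx, hy]; ring
    rw [e, Int.add_emod, Int.mul_emod, this.2, Int.mul_emod y, this.1] at hab
    omega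
  have hdev : |slope * ((2 * a : ℕ) : ℝ) - ((2 * b : ℤ) : ℝ)| = 2 * |y - x * slope| * |err k| := by
    have hxr : (a : ℝ) = x * pell (k + 1) + y * pell k := by exact_mod_cast hx
    have hyr : (b : ℝ) = x * pellNum (k + 1) + y * pellNum k := by exact_mod_cast hy
    have : slope * ((2 * a : ℕ) : ℝ) - ((2 * b : ℤ) : ℝ) = 2 * (y - x * slope) * err k := by
      have h := err_succ k
      push_cast
      rw [hxr, hyr]
      unfold err at *
      linear_combination (2 * (x : ℝ)) * h
    rw [this, abs_mul, abs_mul, abs_two]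
  have hneg : x ≤ -1 → y ≤ 0 → False := by
    intro h₁ h₂
    have : x * (pell (k + 1) : ℤ) < 0 := mul_neg_of_neg_of_pos (by omega) (by exact_mod_cast hpos)
    have : y * (pell k : ℤ) ≤ 0 := mul_nonpos_of_nonpos_of_nonneg h₂ (by positivity)
    omega
  have hzero : x = 0 → y = 0 → False := by
    rintro rfl rfl
    simp at hx
    omega
  have hbig (c : ℕ) : (c : ℤ) ≤ x → 1 ≤ y → c * pell (k + 1) + pell k ≤ a := by
    intro h₁ h₂
    have : (c : ℤ) * pell (k + 1) ≤ x * pell (k + 1) :=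
      mul_le_mul_of_nonneg_right h₁ (by positivity)
    have : 1 * (pell k : ℤ) ≤ y * pell k := mul_le_mul_of_nonneg_right h₂ (by positivity)
    zify
    omega
  have ylt (c : ℤ) (h : (y : ℝ) < c) : y < c := by exact_mod_cast h
  have ygt (c : ℤ) (h : (c : ℝ) < y) : c < y := by exact_mod_cast h
  by_cases hcase : a + 2 < pell (k + 2)
  · have h := abs_lt_err k k₀ (a + 2) (2 * a) (2 * b) hk₁ hq
    rw [hdev] at h
    have h' : |y - x * slope| < 1 / 2 := by nlinarith
    rw [abs_lt] at h'
    obtain ⟨h₁, h₂⟩ := h'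
    rcases le_or_gt 2 x with hx2 | hx2
    · have hx2r : (2 : ℝ) ≤ x := by exact_mod_cast hx2
      have := ygt 0 (by push_cast; nlinarith)
      have := hbig 2 hx2 (by omega)
      simp only [pell] at hcase
      omega
    rcases le_or_gt x (-1) with hxn | hxn
    · have hxr : (x : ℝ) ≤ -1 := by exact_mod_cast hxn
      have := ylt 1 (by push_cast; nlinarith)
      exact hneg hxn (by omega)
    obtain rfl | rfl : x = 0 ∨ x = 1 := by omega
    · have := ylt 1 (by push_cast at *; linarith)
      have := ygt (-1) (by push_cast at *; linarith)
      exact hzero rfl (by omega)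
    · have := ylt 1 (by push_cast at *; linarith)
      have := ygt (-1) (by push_cast at *; linarith)
      omega
  · have h := abs_lt_err_mul k k₀ (a + 2) (2 * a) (2 * b) (by omega) hq
    rw [hdev] at h
    have h' : |y - x * slope| < (1 - slope) / 2 := by nlinarith
    rw [abs_lt] at h'
    obtain ⟨h₁, h₂⟩ := h'
    rcases le_or_gt 3 x with hx3 | hx3
    · have hx3r : (3 : ℝ) ≤ x := by exact_mod_cast hx3
      have := ygt 0 (by push_cast; nlinarith)
      have := hbig 3 hx3 (by omega)
      simp only [pell] at hk₂
      omega
    rcases le_or_gt x (-1) with hxn | hxn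
    · have hxr : (x : ℝ) ≤ -1 := by exact_mod_cast hxn
      have := ylt 1 (by push_cast; nlinarith)
      exact hneg hxn (by omega)
    obtain rfl | rfl | rfl : x = 0 ∨ x = 1 ∨ x = 2 := by omega
    · have := ylt 1 (by push_cast at *; linarith)
      have := ygt (-1) (by push_cast at *; linarith)
      exact hzero rfl (by omega)
    · have := ylt 1 (by push_cast at *; linarith)
      have := ygt 0 (by push_cast at *; linarith)
      omega
    · have := ylt 2 (by push_cast at *; linarith)
      have := ygt 0 (by push_cast at *; linarith)
      omega

/-- A factor of `x₅` with period `p` repeats fewer than `p / 2 + 1` letters. -/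
lemma no_long_repeat (i p : ℕ) (hp : 1 ≤ p)
    (h : ∀ j ≤ p / 2, x5 (i + j) = x5 (i + j + p)) : False := by
  have hconst : ∀ j ≤ p / 2 + 1,
      mech (i + 1 + j + p) - mech (i + 1 + j) = mech (i + 1 + p) - mech (i + 1) := by
    intro j
    induction j with
    | zero => intro _; rfl
    | succ j ih =>
      intro hj
      have ih' := ih (by omega)
      have hm := x5_eq_imp (h j (by omega))
      rw [show i + j + p + 2 = i + 1 + (j + 1) + p by ring,
        show i + j + p + 1 = i + 1 + j + p by ring, show i + j + 2 = i + 1 + (j + 1) by ring,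
        show i + j + 1 = i + 1 + j by ring] at hm
      omega
  have s1 := mech_succ (i + 1)
  have s2 := mech_succ (i + 2)
  have s3 := mech_succ (i + 3)
  have s4 := mech_succ (i + 4)
  have t1 := mech_add_two (i + 1)
  have t3 := mech_add_two (i + 3)
  have u1 := mech_add_three (i + 1)
  by_cases h6 : 6 ≤ p
  · set q := mech (i + 1 + p) - mech (i + 1) with hq
    have hmatch : ∀ j ≤ p / 2,
        (mech (i + (j + 2)) = mech (i + (j + 1)) →
          ((p : ℤ) - q) % 4 = 0 ∨
            ((i : ℤ) + j - mech (i + (j + 1))) % 2 = 0 ∧ ((p : ℤ) - q) % 2 = 0) ∧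
        (mech (i + (j + 2)) ≠ mech (i + (j + 1)) → q % 2 = 0) := by
      intro j hj
      have hm := x5_eq_imp (h j hj)
      have hc := hconst j (by omega)
      rw [show i + 1 + j + p = i + j + p + 1 by ring, show i + 1 + j = i + j + 1 by ring] at hc
      simp only [← Nat.add_assoc]
      push_cast at hm
      omega
    have m0 := hmatch 0 (by omega)
    have m1 := hmatch 1 (by omega)
    have m2 := hmatch 2 (by omega)
    have m3 := hmatch 3 (by omega)
    simp only [Nat.add_assoc, Nat.reduceAdd, Nat.cast_ofNat, Nat.cast_zero, Nat.cast_one]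
      at s1 s2 s3 s4 t1 t3 u1 m0 m1 m2 m3
    have hq2 : q % 2 = 0 := by omega
    have hq4 : ((p : ℤ) - q) % 4 = 0 := by omega
    obtain ⟨a, rfl⟩ : ∃ a, p = 2 * a := ⟨p / 2, by omega⟩
    obtain ⟨b, hb⟩ : ∃ b, q = 2 * b := ⟨q / 2, by omega⟩
    refine not_const_increment (i + 1) a b (by omega) (by push_cast at hq4; omega) ?_
    intro j hj
    have := hconst j (by omega)
    simp only [Nat.add_assoc] at *
    omega
  · have v1 := mech_add_seven (i + 1)
    have m0 := x5_eq_imp (h 0 (by omega))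
    have : p = 1 ∨ p = 2 ∨ p = 3 ∨ p = 4 ∨ p = 5 := by omega
    rcases this with rfl | rfl | rfl | rfl | rfl
    · simp only [Nat.add_assoc, Nat.reduceAdd, Nat.cast_add, Nat.cast_one] at *
      omega
    · have m1 := x5_eq_imp (h 1 (by omega))
      simp only [Nat.add_assoc, Nat.reduceAdd, Nat.cast_add, Nat.cast_ofNat, Nat.cast_one] at *
      omega
    · have m1 := x5_eq_imp (h 1 (by omega))
      simp only [Nat.add_assoc, Nat.reduceAdd, Nat.cast_add, Nat.cast_ofNat, Nat.cast_one] at *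
      omega
    · have m1 := x5_eq_imp (h 1 (by omega))
      have m2 := x5_eq_imp (h 2 (by omega))
      simp only [Nat.add_assoc, Nat.reduceAdd, Nat.cast_add, Nat.cast_ofNat, Nat.cast_one] at *
      omega
    · have m1 := x5_eq_imp (h 1 (by omega))
      have m2 := x5_eq_imp (h 2 (by omega))
      simp only [Nat.add_assoc, Nat.reduceAdd, Nat.cast_add, Nat.cast_ofNat, Nat.cast_one] at *
      omega

end X5

/-- The critical exponent of `x₅` is exactly `3/2`, and it is attained: `3/2` is the
greatest element of the set of exponents `n/p` of factors of `x₅`. -/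
theorem x5_critical_exponent_eq_three_halves :
    IsGreatest {r : ℚ | ∃ i n p : ℕ, 1 ≤ n ∧ 1 ≤ p ∧
      (∀ j, j + p < n → x5 (i + j) = x5 (i + j + p)) ∧ r = (n : ℚ) / (p : ℚ)}
      (3 / 2) := by
  constructor
  · refine ⟨10, 6, 4, by norm_num, by norm_num, ?_, by norm_num⟩
    have g := X5.slope_gt
    have l := X5.slope_lt
    have e11 : X5.mech 11 = 4 := X5.mech_eq (by norm_num; linarith) (by norm_num; linarith)
    have e12 : X5.mech 12 = 4 := X5.mech_eq (by norm_num; linarith) (by norm_num; linarith)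
    have e13 : X5.mech 13 = 5 := X5.mech_eq (by norm_num; linarith) (by norm_num; linarith)
    have e15 : X5.mech 15 = 6 := X5.mech_eq (by norm_num; linarith) (by norm_num; linarith)
    have e16 : X5.mech 16 = 6 := X5.mech_eq (by norm_num; linarith) (by norm_num; linarith)
    have e17 : X5.mech 17 = 7 := X5.mech_eq (by norm_num; linarith) (by norm_num; linarith)
    intro j hj
    obtain rfl | rfl : j = 0 ∨ j = 1 := by omega
    · rw [X5.x5_of_zero (by simp [e11, e12]), X5.x5_of_zero (by simp [e15, e16])]
      simp [e11, e15]
    · rw [X5.x5_of_one (by simp [e13, e12]), X5.x5_of_one (by simp [e17, e16])]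
      simp [e12, e16]
  · rintro r ⟨i, n, p, hn, hp, h, rfl⟩
    by_contra! hlt
    have hp' : (0 : ℚ) < p := by exact_mod_cast hp
    rw [lt_div_iff₀ hp'] at hlt
    have hlt' : 3 * p < 2 * n := by
      have : (3 * p : ℚ) < 2 * n := by linarith
      exact_mod_cast this
    exact X5.no_long_repeat i p hp fun j hj => h j (by omega)
end

section
/- All factors of x_5 with exponent exactly 3/2 have length 6 and period 4. Precisely: for all natural numbers i, n ≥ 1 and p ≥ 1 with 2n = 3p, if x_5[i+j] = x_5[i+j+p] for all j with 0 ≤ j < n − p, then n = 6 and p = 4. -/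
open Finset in
lemma calpha_sum (m : ℕ) :
    ∑ j ∈ Icc 1 m, calpha j = ⌊(Real.sqrt 2 - 1) * ((m : ℝ) + 1)⌋ := by
  induction m with
  | zero =>
    symm
    rw [Icc_eq_empty (by norm_num), sum_empty, Int.floor_eq_zero_iff]
    have h1 : (1 : ℝ) ≤ √2 := Real.one_le_sqrt.2 (by norm_num)
    have h2 : √2 < 2 := by rw [Real.sqrt_lt' (by norm_num)]; norm_num
    constructor <;> push_cast <;> linarith
  | succ m ih =>
    rw [sum_Icc_succ_top (by omega), ih, calpha]
    push_cast
    ring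

lemma calpha_eq_zero_or_one (n : ℕ) : calpha n = 0 ∨ calpha n = 1 := by
  have h1 : (1 : ℝ) ≤ √2 := Real.one_le_sqrt.2 (by norm_num)
  have h2 : √2 < 2 := by rw [Real.sqrt_lt' (by norm_num)]; norm_num
  have hl : ⌊(√2 - 1) * (n : ℝ)⌋ ≤ ⌊(√2 - 1) * ((n : ℝ) + 1)⌋ := by
    gcongr
    linarith
  have hu : ⌊(√2 - 1) * ((n : ℝ) + 1)⌋ ≤ ⌊(√2 - 1) * (n : ℝ) + 1⌋ := by
    gcongr; linarith
  rw [Int.floor_add_one] at hu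
  unfold calpha
  omega

open Finset in
/-- Counting the ones of the Sturmian word recovers the floor function. -/
lemma ocount_eq_floor (m : ℕ) : (ocount m : ℤ) = ⌊(Real.sqrt 2 - 1) * ((m : ℝ) + 1)⌋ := by
  rw [← calpha_sum, ocount, card_filter]
  push_cast
  refine sum_congr rfl fun j _ => ?_
  rcases calpha_eq_zero_or_one j with h | h <;> simp [h]

open Finset in
lemma zcount_add_ocount (m : ℕ) : zcount m + ocount m = m := by
  have h : ((Icc 1 m).filter fun j => calpha j = 1) =
      (Icc 1 m).filter fun j => ¬ calpha j = 0 := by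
    refine filter_congr fun j _ => ?_
    rcases calpha_eq_zero_or_one j with h | h <;> simp [h]
  rw [zcount, ocount, h, card_filter_add_card_filter_not]
  simp

lemma ocount_succ_eq_calpha (m : ℕ) : (ocount (m + 1) : ℤ) = ocount m + calpha (m + 1) := by
  rw [ocount_eq_floor, ocount_eq_floor, calpha]
  push_cast
  ring

lemma ocount_succ (m : ℕ) : ocount (m + 1) = ocount m ∨ ocount (m + 1) = ocount m + 1 := by
  have := ocount_succ_eq_calpha m
  have := calpha_eq_zero_or_one (m + 1)
  omega

lemma ocount_add_two_le (m : ℕ) : ocount (m + 2) ≤ ocount m + 1 := by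
  have h : √2 < 3 / 2 := by rw [Real.sqrt_lt' (by norm_num)]; norm_num
  have hu : ⌊(√2 - 1) * (((m + 2 : ℕ) : ℝ) + 1)⌋ ≤ ⌊(√2 - 1) * ((m : ℝ) + 1) + 1⌋ := by
    gcongr; push_cast; linarith
  rw [Int.floor_add_one, ← ocount_eq_floor, ← ocount_eq_floor] at hu
  exact_mod_cast hu

lemma le_ocount_add_three (m : ℕ) : ocount m + 1 ≤ ocount (m + 3) := by
  have h : 4 / 3 < √2 := by rw [Real.lt_sqrt (by norm_num)]; norm_num
  have hu : ⌊(√2 - 1) * ((m : ℝ) + 1) + 1⌋ ≤ ⌊(√2 - 1) * (((m + 3 : ℕ) : ℝ) + 1)⌋ := by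
    gcongr; push_cast; linarith
  rw [Int.floor_add_one, ← ocount_eq_floor, ← ocount_eq_floor] at hu
  exact_mod_cast hu

lemma x5_of_ocount_succ_eq {i : ℕ} (h : ocount (i + 1) = ocount i) :
    x5 i = [0, 1, 0, 2].getD ((i - ocount i) % 4) 0 := by
  have h1 := ocount_succ_eq_calpha i
  have h2 := zcount_add_ocount (i + 1)
  rw [x5, if_pos (by omega)]
  congr 2
  omega

lemma x5_of_ocount_succ_eq_add_one {i : ℕ} (h : ocount (i + 1) = ocount i + 1) :
    x5 i = [3, 4].getD (ocount i % 2) 0 := by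
  have h1 := ocount_succ_eq_calpha i
  rw [x5, if_neg (by omega)]
  congr 2
  omega

lemma getD_zeros_cases (n : ℕ) :
    n % 2 = 0 ∧ [0, 1, 0, 2].getD (n % 4) 0 = 0 ∨
    n % 4 = 1 ∧ [0, 1, 0, 2].getD (n % 4) 0 = 1 ∨
    n % 4 = 3 ∧ [0, 1, 0, 2].getD (n % 4) 0 = 2 := by
  have : n % 4 = 0 ∨ n % 4 = 1 ∨ n % 4 = 2 ∨ n % 4 = 3 := by omega
  rcases this with h | h | h | h <;> simp [h] <;> omega

lemma getD_ones_cases (n : ℕ) :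
    n % 2 = 0 ∧ [3, 4].getD (n % 2) 0 = 3 ∨ n % 2 = 1 ∧ [3, 4].getD (n % 2) 0 = 4 := by
  rcases Nat.mod_two_eq_zero_or_one n with h | h <;> simp [h]

/-- Equal letters of `x5` come from equal letters of the Sturmian word, at positions which agree
as far as the colouring can tell. -/
lemma x5_eq_cases {i i' : ℕ} (h : x5 i = x5 i') :
    (ocount (i + 1) = ocount i ∧ ocount (i' + 1) = ocount i' ∧
      ((i - ocount i) % 2 = 0 ∧ (i' - ocount i') % 2 = 0 ∨
       (i - ocount i) % 2 = 1 ∧ (i - ocount i) % 4 = (i' - ocount i') % 4)) ∨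
    (ocount (i + 1) = ocount i + 1 ∧ ocount (i' + 1) = ocount i' + 1 ∧
      ocount i % 2 = ocount i' % 2) := by
  rcases ocount_succ i with h1 | h1 <;> rcases ocount_succ i' with h2 | h2
  · rw [x5_of_ocount_succ_eq h1, x5_of_ocount_succ_eq h2] at h
    have := getD_zeros_cases (i - ocount i)
    have := getD_zeros_cases (i' - ocount i')
    omega
  · rw [x5_of_ocount_succ_eq h1, x5_of_ocount_succ_eq_add_one h2] at h
    have := getD_zeros_cases (i - ocount i)
    have := getD_ones_cases (ocount i')
    omega
  · rw [x5_of_ocount_succ_eq_add_one h1, x5_of_ocount_succ_eq h2] at h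
    have := getD_ones_cases (ocount i)
    have := getD_zeros_cases (i' - ocount i')
    omega
  · rw [x5_of_ocount_succ_eq_add_one h1, x5_of_ocount_succ_eq_add_one h2] at h
    have := getD_ones_cases (ocount i)
    have := getD_ones_cases (ocount i')
    omega

lemma ocount_add_eq_of_x5_eq {i i' k : ℕ} (h : ∀ j < k, x5 (i + j) = x5 (i' + j)) :
    ∀ j ≤ k, ocount (i' + j) + ocount i = ocount (i + j) + ocount i' := by
  intro j hj
  induction j with
  | zero => simp [add_comm]
  | succ j ih =>
    have := x5_eq_cases (h j (by omega))
    have := ih (by omega)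
    rw [← add_assoc, ← add_assoc]
    omega

/-- If a backward step of `s` and a forward step of `t` both move points by at most `d` in the
positive direction (modulo 1), then every orbit segment of at least `s + t + 1` points of the
rotation by `α` meets `[1 - d, 1)` modulo 1. -/
lemma exists_one_le_fract_add {α d : ℝ} {y : ℝ} {k s t : ℕ} {m n : ℤ} (hst : s + t ≤ k)
    (hs0 : 0 < m - s * α) (hsd : m - s * α ≤ d) (ht0 : 0 < t * α - n) (htd : t * α - n ≤ d) :
    ∃ j ≤ k, 1 ≤ Int.fract (y + j * α) + d := by
  obtain ⟨j, hj, hmax⟩ := Finset.exists_max_image (Finset.range (k + 1))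
    (fun j : ℕ => Int.fract (y + j * α)) ⟨0, by simp⟩
  simp only [Finset.mem_range, Nat.lt_succ_iff] at hj hmax
  refine ⟨j, hj, ?_⟩
  by_contra! hlt
  have key : ∀ j' ≤ k, ∀ r : ℝ, ∀ z : ℤ, 0 < r → r ≤ d → y + j' * α = y + j * α + r + z →
      False := by
    intro j' hj' r z h0 hd he
    have h1 : Int.fract (y + j' * α) = Int.fract (y + j * α) + r := by
      rw [Int.fract_eq_iff]
      have := Int.fract_nonneg (y + j * α)
      refine ⟨by linarith, by linarith, ⌊y + j * α⌋ + z, ?_⟩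
      have := Int.floor_add_fract (y + j * α)
      push_cast
      linarith
    have := hmax j' hj'
    linarith
  rcases le_or_gt s j with h | h
  · refine key (j - s) (by omega) _ (-m) hs0 hsd ?_
    push_cast [h]
    ring
  · refine key (j + t) (by omega) _ n ht0 htd ?_
    push_cast
    ring

/-- The mirror image of `exists_one_le_fract_add`. -/
lemma exists_fract_lt {α d : ℝ} {y : ℝ} {k s t : ℕ} {m n : ℤ} (hst : s + t ≤ k)
    (hs0 : 0 < s * α - m) (hsd : s * α - m ≤ d) (ht0 : 0 < n - t * α) (htd : n - t * α ≤ d) :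
    ∃ j ≤ k, Int.fract (y + j * α) < d := by
  obtain ⟨j, hj, hmin⟩ := Finset.exists_min_image (Finset.range (k + 1))
    (fun j : ℕ => Int.fract (y + j * α)) ⟨0, by simp⟩
  simp only [Finset.mem_range, Nat.lt_succ_iff] at hj hmin
  refine ⟨j, hj, ?_⟩
  by_contra! hlt
  have key : ∀ j' ≤ k, ∀ r : ℝ, ∀ z : ℤ, 0 < r → r ≤ d → y + j' * α = y + j * α - r + z →
      False := by
    intro j' hj' r z h0 hd he
    have h1 : Int.fract (y + j' * α) = Int.fract (y + j * α) - r := by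
      rw [Int.fract_eq_iff]
      have := Int.fract_lt_one (y + j * α)
      refine ⟨by linarith, by linarith, ⌊y + j * α⌋ + z, ?_⟩
      have := Int.floor_add_fract (y + j * α)
      push_cast
      linarith
    have := hmin j' hj'
    linarith
  rcases le_or_gt s j with h | h
  · refine key (j - s) (by omega) _ (-m) hs0 hsd ?_
    push_cast [h]
    ring
  · refine key (j + t) (by omega) _ n ht0 htd ?_
    push_cast
    ring

/-- A factor of length `k` of the Sturmian word cannot reappear after `2k` letters if these contain
`2a` ones with `a ≡ k` modulo 2. -/
lemma not_ocount_translate {i k b c : ℕ} (hbc : b + c = k) (hk : 0 < k)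
    (h : ∀ j ≤ k, (ocount (i + 2 * k + j) : ℤ) = ocount (i + j) + 2 * (2 * b - k)) : False := by
  have hsq : √2 * √2 = 2 := Real.mul_self_sqrt (by norm_num)
  have h1 : 1 < √2 := by rw [Real.lt_sqrt (by norm_num)]; norm_num
  have hbcR : (b : ℝ) + c = k := by exact_mod_cast hbc
  set α := √2 - 1 with hα
  set y : ℝ := α * ((i : ℝ) + 1) with hy
  set e : ℝ := k - b * √2 with he
  -- `δ = 2√2 e` is the displacement under the translation by `2k` letters
  have hδ : ∀ j ≤ k, 0 ≤ Int.fract (y + j * α) + 2 * √2 * e ∧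
      Int.fract (y + j * α) + 2 * √2 * e < 1 := by
    intro j hj
    have hf := h j hj
    rw [ocount_eq_floor, ocount_eq_floor, ← hα, Int.floor_eq_iff] at hf
    have harg : α * (((i + j : ℕ) : ℝ) + 1) = y + j * α := by push_cast; ring
    rw [harg] at hf
    have hfr := Int.floor_add_fract (y + j * α)
    have harg2 : α * (((i + 2 * k + j : ℕ) : ℝ) + 1) =
        y + j * α + 2 * √2 * e + 2 * (2 * b - k) := by
      rw [he, hy, hα]; push_cast; linear_combination (2 * (b : ℝ)) * hsq
    rw [harg2] at hf
    push_cast at hf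
    constructor <;> linarith [hf.1, hf.2]
  have hbα : (b : ℝ) * α - (c : ℤ) = -e := by
    rw [hα, he]; push_cast; linear_combination -hbcR
  have hcα : (c : ℝ) * α - (b - 2 * c : ℤ) = (1 + √2) * e := by
    rw [hα, he]; push_cast; linear_combination (1 + √2) * hbcR + (b : ℝ) * hsq
  rcases lt_trichotomy e 0 with hneg | hzero | hpos
  · obtain ⟨j, hj, hlt⟩ := exists_fract_lt (α := α) (d := -(2 * √2 * e)) (y := y) (k := k)
      (s := b) (t := c) (m := (c : ℤ)) (n := (b - 2 * c : ℤ)) hbc.le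
      (by linarith) (by nlinarith) (by nlinarith) (by nlinarith)
    linarith [(hδ j hj).1]
  · have hirr := irrational_sqrt_two
    have hb : b ≠ 0 := by
      rintro rfl
      have : (k : ℝ) = 0 := by simpa [he] using hzero
      have : k = 0 := by exact_mod_cast this
      omega
    refine hirr ⟨(k : ℚ) / b, ?_⟩
    push_cast
    rw [div_eq_iff (by exact_mod_cast hb)]
    linarith
  · obtain ⟨j, hj, hle⟩ := exists_one_le_fract_add (α := α) (d := 2 * √2 * e) (y := y) (k := k)
      (s := b) (t := c) (m := (c : ℤ)) (n := (b - 2 * c : ℤ)) hbc.le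
      (by linarith) (by nlinarith) (by nlinarith) (by nlinarith)
    linarith [(hδ j hj).2]

lemma ocount_le_ocount_add (i m : ℕ) :
    ocount i ≤ ocount (i + m) ∧ ocount (i + m) ≤ ocount i + m := by
  induction m with
  | zero => simp
  | succ m ih =>
    have := ocount_succ (i + m)
    rw [← add_assoc]
    omega

/-- Every factor of `x₅` of exponent exactly `3/2` has length `6` and period `4`. -/
theorem x5_exact_three_halves_powers (i n p : ℕ) (hn : 1 ≤ n) (hp : 1 ≤ p)
    (hexp : 2 * n = 3 * p)
    (hper : ∀ j, j + p < n → x5 (i + j) = x5 (i + j + p)) :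
    n = 6 ∧ p = 4 := by
  obtain ⟨k, rfl⟩ : ∃ k, p = 2 * k := ⟨p / 2, by omega⟩
  obtain rfl : n = 3 * k := by omega
  have hx : ∀ j < k, x5 (i + j) = x5 (i + 2 * k + j) := by
    intro j hj
    rw [hper j (by omega)]
    congr 1
    omega
  by_contra hk2
  have hO := ocount_add_eq_of_x5_eq hx
  obtain ⟨D, hD⟩ : ∃ D, ocount (i + 2 * k) = ocount i + D :=
    Nat.exists_eq_add_of_le (ocount_le_ocount_add i (2 * k)).1
  have hD2 : D ≤ 2 * k := by have := (ocount_le_ocount_add i (2 * k)).2; omega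
  have hle : ∀ m, ocount m ≤ m := fun m => by have := zcount_add_ocount m; omega
  have hx' : ∀ j < k, _ := fun j hj => x5_eq_cases (hx j hj)
  have two := ocount_add_two_le
  have three := le_ocount_add_three
  have succ := ocount_succ
  have key : D % 2 = 0 ∧ (2 * k - D) % 4 = 0 := by
    have hlet : ∀ j < k, ocount (i + j + 1) = ocount (i + j) ∧
        ((i + j - ocount (i + j)) % 2 = 0 ∧ (2 * k - D) % 2 = 0 ∨
          (i + j - ocount (i + j)) % 2 = 1 ∧ (2 * k - D) % 4 = 0) ∨
        ocount (i + j + 1) = ocount (i + j) + 1 ∧ D % 2 = 0 := by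
      intro j hj
      have := hx' j hj
      have := hO j hj.le
      have := hle (i + j)
      omega
    have l0 := hlet 0 (by omega)
    simp only [add_zero] at l0
    obtain rfl | rfl | hk4 : k = 1 ∨ k = 3 ∨ 4 ≤ k := by omega
    · have := three i
      have := two (i + 1)
      have := two i
      have := succ (i + 1)
      have := hO 1 le_rfl
      simp only [add_assoc, Nat.reduceAdd, Nat.reduceMul] at *
      omega
    · have := hlet 1 (by omega)
      have := hlet 2 (by omega)
      have := three i
      have := three (i + 3)
      have := two i
      have := two (i + 2)
      have := two (i + 4)
      have := hle i
      simp only [add_assoc, Nat.reduceAdd, Nat.reduceMul] at *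
      omega
    · have := hlet 1 (by omega)
      have := hlet 2 (by omega)
      have := hlet 3 (by omega)
      have := three i
      have := two i
      have := two (i + 1)
      have := two (i + 2)
      have := hle i
      simp only [add_assoc, Nat.reduceAdd] at *
      omega
  obtain ⟨b, hb⟩ : ∃ b, D + 2 * k = 4 * b := ⟨(D + 2 * k) / 4, by omega⟩
  refine not_ocount_translate (i := i) (k := k) (b := b) (c := k - b) (by omega) (by omega) ?_
  intro j hj
  have := hO j hj
  omega
end

section
/- Every balanced word of length 45 over a 5-letter alphabet contains a factor with exponent at least 3/2: if w : Fin 45 → Σ with |Σ| = 5 is balanced, then there exist i, n ≥ 1 and p ≥ 1 with i + n ≤ 45, n > p, 2n ≥ 3p, and w[i+j] = w[i+j+p] for all 0 ≤ j < n − p. -/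
/-- `excess x l m`: some prefix of `l` has one more occurrence of `x` than the prefix of `m` of
the same length, and no shorter prefix of `l` has fewer occurrences than that of `m`.
This definition and the next three use recursors so that they evaluate quickly in the kernel. -/
def excess (x : ℕ) (l : List ℕ) : List ℕ → Bool :=
  List.rec (fun _ => false) (fun c _ ih m =>
    List.rec false (fun d m _ =>
      Bool.rec (Bool.rec (ih m) false (Nat.beq d x)) (Bool.rec true (ih m) (Nat.beq d x))
        (Nat.beq c x)) m) l

/-- `unbalanced c l m`: the word `c :: l` and one of the nonempty suffixes of `m` have prefixes of
equal length in which the numbers of occurrences of some letter differ by two. -/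
def unbalanced (c : ℕ) (l m : List ℕ) : Bool :=
  List.rec false (fun d m ih =>
    Bool.rec (Bool.rec (Bool.rec ih true (excess d m l)) true (excess c l m)) ih (Nat.beq c d)) m

/-- The lists `l` and `m` have the same prefix of length `k`. -/
def agree (k : ℕ) : List ℕ → List ℕ → Bool :=
  Nat.rec (fun _ _ => true) (fun _ ih l m => List.rec false (fun c l _ =>
    List.rec false (fun d m _ => Bool.rec false (ih l m) (Nat.beq c d)) m) l) k

/-- When `m` is `l` with its first `p` letters removed, `repetitive l m p` says that
`l` has a prefix with a period at least `p` and exponent at least `3/2`. -/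
def repetitive (l m : List ℕ) : ℕ → Bool :=
  List.rec (fun _ => false) (fun d m ih p =>
    Bool.rec (ih (Nat.succ p)) true (agree (Nat.div (Nat.succ p) 2) l (d :: m))) m

/-- A sufficient condition for a word to be unbalanced or to start with a factor of exponent at
least `3/2`. -/
def rejected : List ℕ → Bool
  | [] => false
  | c :: l => repetitive (c :: l) l 1 || unbalanced c l l

/-- Every way of prepending `f` letters below `5` to `l`, new letters being introduced in increasing
order starting from `k`, passes through a rejected word. -/
def exhausted : ℕ → ℕ → List ℕ → Bool
  | 0, _, _ => false
  | f + 1, k, l => [0, 1, 2, 3, 4].all fun a =>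
      Nat.blt k a || (rejected (a :: l) ||
        cond (Nat.beq a k) (exhausted f (k + 1) (a :: l)) (exhausted f k (a :: l)))

theorem exhausted_nil : exhausted 45 0 [] = true := by
  decide +kernel

theorem beq_eq_false_of_ne {a b : ℕ} (h : a ≠ b) : Nat.beq a b = false :=
  Bool.eq_false_iff.2 fun e => h (Nat.eq_of_beq_eq_true e)

theorem excess_cons_cons (x c d : ℕ) (l m : List ℕ) :
    excess x (c :: l) (d :: m) =
      if c = x then (if d = x then excess x l m else true)
      else (if d = x then false else excess x l m) := by
  change (Bool.rec (Bool.rec (excess x l m) false (Nat.beq d x))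
    (Bool.rec true (excess x l m) (Nat.beq d x)) (Nat.beq c x) : Bool) = _
  by_cases hc : c = x <;> by_cases hd : d = x <;> simp [hc, hd, beq_eq_false_of_ne]

theorem unbalanced_cons (c d : ℕ) (l m : List ℕ) :
    unbalanced c l (d :: m) =
      ((!decide (c = d) && (excess c l m || excess d m l)) || unbalanced c l m) := by
  change (Bool.rec (Bool.rec (Bool.rec (unbalanced c l m) true (excess d m l)) true (excess c l m))
    (unbalanced c l m) (Nat.beq c d) : Bool) = _
  by_cases hc : c = d
  · simp [hc]
  · cases h : excess c l m <;> cases h' : excess d m l <;> simp [hc, beq_eq_false_of_ne]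

theorem agree_succ_cons_cons (k c d : ℕ) (l m : List ℕ) :
    agree (k + 1) (c :: l) (d :: m) = (decide (c = d) && agree k l m) := by
  change (Bool.rec false (agree k l m) (Nat.beq c d) : Bool) = _
  by_cases hc : c = d <;> simp [hc, beq_eq_false_of_ne]

theorem repetitive_cons (d p : ℕ) (l m : List ℕ) :
    repetitive l (d :: m) p = (agree ((p + 1) / 2) l (d :: m) || repetitive l m (p + 1)) := by
  change (Bool.rec (repetitive l m (p + 1)) true (agree ((p + 1) / 2) l (d :: m)) : Bool) = _
  cases h : agree ((p + 1) / 2) l (d :: m) <;> simp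

/-- The prefix of length `n` of the sequence `u`, last letter first. -/
def reversedStart (u : ℕ → ℕ) : ℕ → List ℕ
  | 0 => []
  | n + 1 => u n :: reversedStart u n

theorem reversedStart_congr {u v : ℕ → ℕ} {n : ℕ} (h : ∀ j < n, u j = v j) :
    reversedStart u n = reversedStart v n := by
  induction n with
  | zero => rfl
  | succ n ih => rw [reversedStart, reversedStart, h n (by omega), ih fun j hj => h j (by omega)]

/-- The number of occurrences of `x` in the factor of `u` of length `n` at position `i`. -/
def occurrences (u : ℕ → ℕ) (x i n : ℕ) : ℕ :=
  ((Finset.Ico i (i + n)).filter fun j => u j = x).card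

theorem occurrences_succ (u : ℕ → ℕ) (x i n : ℕ) :
    occurrences u x i (n + 1) = occurrences u x i n + if u (i + n) = x then 1 else 0 := by
  unfold occurrences
  rw [← add_assoc, Nat.Ico_succ_right_eq_insert_Ico (by omega), Finset.filter_insert]
  split_ifs <;> simp

theorem excess_reversedStart {u : ℕ → ℕ} {x a b : ℕ}
    (h : excess x (reversedStart u a) (reversedStart u b) = true) :
    ∃ i i' n, i + n = a ∧ i' + n = b ∧ occurrences u x i n = occurrences u x i' n + 1 := by
  induction a generalizing b with
  | zero => cases h
  | succ a ih =>
    cases b with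
    | zero => cases h
    | succ b =>
      rw [reversedStart, reversedStart, excess_cons_cons] at h
      have extend (hi : excess x (reversedStart u a) (reversedStart u b) = true)
          (hab : u a = x ↔ u b = x) :
          ∃ i i' n, i + n = a + 1 ∧ i' + n = b + 1 ∧
            occurrences u x i n = occurrences u x i' n + 1 := by
        obtain ⟨i, i', n, rfl, rfl, h⟩ := ih hi
        refine ⟨i, i', n + 1, rfl, rfl, ?_⟩
        rw [occurrences_succ, occurrences_succ]
        simp only [hab]
        omega
      split_ifs at h with hc hd hd
      · exact extend h (by simp [hc, hd])
      · refine ⟨a, b, 1, rfl, rfl, ?_⟩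
        simp [occurrences, Finset.filter_singleton, hc, hd]
      · exact extend h (by simp [hc, hd])

theorem agree_reversedStart {u : ℕ → ℕ} {k a b : ℕ}
    (h : agree k (reversedStart u a) (reversedStart u b) = true) :
    k ≤ a ∧ k ≤ b ∧ ∀ j < k, u (a - k + j) = u (b - k + j) := by
  induction k generalizing a b with
  | zero => simp
  | succ k ih =>
    cases a with
    | zero => cases h
    | succ a =>
      cases b with
      | zero => cases h
      | succ b =>
        rw [reversedStart, reversedStart, agree_succ_cons_cons, Bool.and_eq_true,
          decide_eq_true_eq] at h
        obtain ⟨ha, hb, hu⟩ := ih h.2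
        refine ⟨by omega, by omega, fun j hj => ?_⟩
        rw [Nat.add_sub_add_right, Nat.add_sub_add_right]
        rcases Nat.lt_succ_iff_lt_or_eq.1 hj with hj | rfl
        · exact hu j hj
        · rw [Nat.sub_add_cancel ha, Nat.sub_add_cancel hb]
          exact h.1

/-- The sequence `u` has its first `45` letters below `5`, and they form a balanced word without
factors of exponent at least `3/2`. -/
structure Admissible (u : ℕ → ℕ) : Prop where
  lt : ∀ j < 45, u j < 5
  balanced : ∀ x i i' n, i + n ≤ 45 → i' + n ≤ 45 → occurrences u x i n ≤ occurrences u x i' n + 1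
  free : ∀ i p k, 1 ≤ p → p ≤ 2 * k → i + p + k ≤ 45 → ∃ j < k, u (i + j) ≠ u (i + j + p)

theorem Admissible.comp_perm {u : ℕ → ℕ} (hu : Admissible u) (σ : Equiv.Perm ℕ)
    (hσ : ∀ a < 5, σ a < 5) : Admissible (σ ∘ u) where
  lt j hj := hσ _ (hu.lt j hj)
  balanced x i i' n h h' := by
    have e (i : ℕ) : occurrences (σ ∘ u) x i n = occurrences u (σ.symm x) i n := by
      simp [occurrences, Equiv.eq_symm_apply]
    rw [e, e]
    exact hu.balanced _ i i' n h h'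
  free i p k h₁ h₂ h₃ := by
    obtain ⟨j, hj, h⟩ := hu.free i p k h₁ h₂ h₃
    exact ⟨j, hj, fun e => h (σ.injective e)⟩

theorem Admissible.unbalanced_eq_false {u : ℕ → ℕ} (hu : Admissible u) {n m : ℕ} (hn : n < 45)
    (hm : m ≤ n) : unbalanced (u n) (reversedStart u n) (reversedStart u m) = false := by
  have key {a b : ℕ} (ha : a < 45) (hb : b < 45) (hab : u b ≠ u a) :
      excess (u a) (reversedStart u a) (reversedStart u b) = false := by
    by_contra h
    obtain ⟨i, i', l, rfl, rfl, h⟩ := excess_reversedStart (by simpa using h)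
    have := hu.balanced (u (i + l)) i i' (l + 1) (by omega) (by omega)
    rw [occurrences_succ, occurrences_succ, if_pos rfl, if_neg hab] at this
    omega
  induction m with
  | zero => rfl
  | succ m ih =>
    rw [reversedStart, unbalanced_cons, ih (by omega), Bool.or_false]
    by_cases h : u n = u m
    · simp [h]
    · rw [key (by omega) (by omega) (Ne.symm h), key (by omega) (by omega) h]
      simp

theorem Admissible.repetitive_eq_false {u : ℕ → ℕ} (hu : Admissible u) {m p : ℕ} (hp : 1 ≤ p)
    (hmp : m + p ≤ 45) : repetitive (reversedStart u (m + p)) (reversedStart u m) p = false := by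
  induction m generalizing p with
  | zero => rfl
  | succ m ih =>
    rw [reversedStart, repetitive_cons, show m + 1 + p = m + (p + 1) by omega,
      ih (by omega) (by omega), Bool.or_false]
    by_contra h
    obtain ⟨-, hk, h⟩ := agree_reversedStart (b := m + 1) (Bool.not_eq_false _ ▸ h)
    obtain ⟨j, hj, hne⟩ := hu.free (m + 1 - (p + 1) / 2) p ((p + 1) / 2) hp (by omega) (by omega)
    refine hne ?_
    rw [← h j hj]
    congr 1
    omega

theorem Admissible.rejected_eq_false {u : ℕ → ℕ} (hu : Admissible u) {n : ℕ} (hn : n < 45) :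
    rejected (reversedStart u (n + 1)) = false := by
  rw [reversedStart, rejected, ← reversedStart, hu.repetitive_eq_false le_rfl hn,
    hu.unbalanced_eq_false hn le_rfl]
  rfl

theorem Admissible.exhausted_eq_false {u : ℕ → ℕ} (hu : Admissible u) {f k n : ℕ}
    (hf : f + n = 45) (hk : ∀ j < n, u j < k) : exhausted f k (reversedStart u n) = false := by
  induction f generalizing u k n with
  | zero => rfl
  | succ f ih =>
    have step {v : ℕ → ℕ} (hv : Admissible v) (hvk : ∀ j < n, v j < k) (hvn : v n ≤ k) :
        exhausted (f + 1) k (reversedStart v n) = false := by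
      rw [exhausted, List.all_eq_false]
      refine ⟨v n, ?_, ?_⟩
      · have := hv.lt n (by omega)
        simp
        omega
      · rw [← reversedStart, hv.rejected_eq_false (by omega)]
        have hblt : Nat.blt k (v n) = false := by
          rw [← Bool.not_eq_true, Nat.blt_eq]
          omega
        rw [hblt]
        by_cases h : v n = k
        · have := ih (k := k + 1) (n := n + 1) hv (by omega) fun j hj => by
            rcases Nat.lt_succ_iff_lt_or_eq.1 hj with hj | rfl
            · exact (hvk j hj).trans k.lt_succ_self
            · omega
          simp [h, this]
        · have := ih (k := k) (n := n + 1) hv (by omega) fun j hj => by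
            rcases Nat.lt_succ_iff_lt_or_eq.1 hj with hj | rfl
            · exact hvk j hj
            · omega
          simp [h, this]
    rcases le_or_gt (u n) k with h | h
    · exact step hu hk h
    · have hn := hu.lt n (by omega)
      have hfix : ∀ j < n, (Equiv.swap k (u n) ∘ u) j = u j := fun j hj => by
        have := hk j hj
        exact Equiv.swap_apply_of_ne_of_ne (by omega) (by omega)
      rw [← reversedStart_congr hfix]
      refine step (hu.comp_perm _ fun a ha => ?_) (fun j hj => ?_) ?_
      · rw [Equiv.swap_apply_def]
        split_ifs <;> omega
      · rw [hfix j hj]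
        exact hk j hj
      · simp

theorem not_admissible (u : ℕ → ℕ) : ¬ Admissible u := fun hu => by
  have := hu.exhausted_eq_false (f := 45) (k := 0) (n := 0) rfl (by simp)
  rw [reversedStart, exhausted_nil] at this
  cases this


/-- Every balanced word of length 45 over a 5-letter alphabet contains a factor of
exponent at least `3/2`. -/
theorem balanced_length_45_has_three_halves_power
    (A : Type) [Fintype A] [DecidableEq A] (hA : Fintype.card A = 5)
    (w : Fin 45 → A)
    (hbal : ∀ (a : A) (i i' n : ℕ), i + n ≤ 45 → i' + n ≤ 45 →
      (((Finset.univ.filter fun j : Fin 45 => i ≤ (j : ℕ) ∧ (j : ℕ) < i + n ∧ w j = a).card : ℤ) -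
        ((Finset.univ.filter fun j : Fin 45 => i' ≤ (j : ℕ) ∧ (j : ℕ) < i' + n ∧ w j = a).card : ℤ)).natAbs ≤ 1) :
    ∃ i n p : ℕ, 1 ≤ p ∧ p < n ∧ i + n ≤ 45 ∧ 3 * p ≤ 2 * n ∧
      ∀ j k : Fin 45, i ≤ (j : ℕ) → (k : ℕ) = (j : ℕ) + p → (j : ℕ) + p < i + n →
        w j = w k := by
  let e : A ≃ Fin 5 := Fintype.equivFinOfCardEq hA
  let u : ℕ → ℕ := fun j => if h : j < 45 then e (w ⟨j, h⟩) else 0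
  have hu (j : Fin 45) : u j = e (w j) := dif_pos j.isLt
  by_contra hfree
  refine not_admissible u ⟨fun j hj => ?_, fun x i i' n hi hi' => ?_, fun i p k hp hk hi => ?_⟩
  · rw [hu ⟨j, hj⟩]
    exact (e _).isLt
  · by_cases hx : x < 5
    · have hocc (i : ℕ) (hi : i + n ≤ 45) : occurrences u x i n =
          (Finset.univ.filter fun j : Fin 45 =>
            i ≤ (j : ℕ) ∧ (j : ℕ) < i + n ∧ w j = e.symm ⟨x, hx⟩).card := by
        rw [occurrences, ← Finset.card_map Fin.valEmbedding]
        congr 1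
        ext j
        simp only [Finset.mem_filter, Finset.mem_Ico, Finset.mem_map, Finset.mem_univ, true_and,
          Fin.valEmbedding_apply, Equiv.eq_symm_apply, Fin.ext_iff, ← hu]
        constructor
        · rintro ⟨⟨h₁, h₂⟩, h₃⟩
          exact ⟨⟨j, by omega⟩, ⟨h₁, h₂, h₃⟩, rfl⟩
        · rintro ⟨j, ⟨h₁, h₂, h₃⟩, rfl⟩
          exact ⟨⟨h₁, h₂⟩, h₃⟩
      have := hbal (e.symm ⟨x, hx⟩) i i' n hi hi'
      rw [← hocc i hi, ← hocc i' hi'] at this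
      omega
    · have : occurrences u x i n = 0 := by
        rw [occurrences, Finset.card_eq_zero, Finset.filter_eq_empty_iff]
        intro j hj hjx
        have hj' : j < 45 := by
          rw [Finset.mem_Ico] at hj
          omega
        have := (e (w ⟨j, hj'⟩)).isLt
        rw [← hu ⟨j, hj'⟩] at this
        exact hx (hjx ▸ this)
      omega
  · by_contra! h
    refine hfree ⟨i, p + k, p, hp, by omega, by omega, by omega, fun j j' hij hj' hj => ?_⟩
    have := h (j - i) (by omega)
    rw [Nat.add_sub_cancel' hij, ← hj', hu, hu] at this
    exact e.injective (Fin.ext this)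
end

section
/- Every infinite balanced word over an alphabet of at most 5 letters has critical exponent at least 3/2: if w is an infinite balanced word over Σ with |Σ| ≤ 5, then the supremum of n/p over all factors of w of length n having period p ≥ 1 is at least 3/2. -/
namespace BalancedWord

/-! Words are stored as lists of letters with the most recent letter first. The functions evaluated
by the backtracking search are written with recursors, and lists of occurrences are recomputed from
shared sublists, so that the kernel evaluates them quickly. -/

/-- The first `n` letters of `f`, most recent letter first. -/
def initial {α : Type*} (f : ℕ → α) : ℕ → List α
  | 0 => []
  | n + 1 => f n :: initial f n

/-- The length of a list. -/
noncomputable def len (l : List ℕ) : ℕ :=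
  @List.rec ℕ (fun _ => ℕ) (nat_lit 0) (fun _ _ ih => Nat.succ ih) l

/-- Conjunction, evaluated from the left. -/
noncomputable def both (x y : Bool) : Bool :=
  @Bool.rec (fun _ => Bool) false y x

/-- Whether the two lists agree on their first `n` entries (both having at least `n` entries). -/
noncomputable def agree (l : List ℕ) : List ℕ → ℕ → Bool :=
  @List.rec ℕ (fun _ => List ℕ → ℕ → Bool) (fun _ n => Nat.beq n (nat_lit 0)) (fun x _ ih m n =>
    @Bool.rec (fun _ => Bool)
      (@List.rec ℕ (fun _ => Bool) false (fun y m' _ => both (Nat.beq x y) (ih m' (Nat.pred n))) m)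
      true (Nat.beq n (nat_lit 0))) l

/-- The parts of `l` preceding the occurrences of `b`. -/
noncomputable def occurrences (b : ℕ) (l : List ℕ) : List (List ℕ) :=
  @List.rec ℕ (fun _ => List (List ℕ)) []
    (fun x m ih => @Bool.rec (fun _ => List (List ℕ)) ih (m :: ih) (Nat.beq x b)) l

/-- After appending a letter with occurrences `r` to `l`, no factor reaching back to one of these
occurrences is repeated on half of its length. -/
noncomputable def noRepetition (l : List ℕ) (r : List (List ℕ)) : Bool :=
  @List.rec (List ℕ) (fun _ => Bool) true (fun m _ ih =>
    @Bool.rec (fun _ => Bool) ih false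
      (agree l m (Nat.div (Nat.pred (Nat.sub (len l) (len m))) (nat_lit 2)))) r

/-- Whether two numbers differ by at most one. -/
noncomputable def near (x y : ℕ) : Bool :=
  both (Nat.ble x (Nat.succ y)) (Nat.ble y (Nat.succ x))

/-- Whether all gaps between consecutive occurrences `p, r` are near `g`. -/
noncomputable def gapsNear (g : ℕ) (r : List (List ℕ)) : ℕ → Bool :=
  @List.rec (List ℕ) (fun _ => ℕ → Bool) (fun _ => true)
    (fun m _ ih p => both (near g (Nat.sub p (len m))) (ih (len m))) r

/-- Whether all sums of two consecutive gaps between the occurrences `p, q, r` are near `g`. -/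
noncomputable def gapSumsNear (g : ℕ) (r : List (List ℕ)) : ℕ → ℕ → Bool :=
  @List.rec (List ℕ) (fun _ => ℕ → ℕ → Bool) (fun _ _ => true)
    (fun m _ ih p q => both (near g (Nat.sub p (len m))) (ih q (len m))) r

/-- Balance conditions on the gaps between the occurrences `r` of the letter to be appended at
position `n`; the last gap must also be at least `h`. -/
noncomputable def gapsBalanced (h n : ℕ) (r : List (List ℕ)) : Bool :=
  @List.rec (List ℕ) (fun _ => Bool) true (fun m r' _ =>
    both (Nat.ble h (Nat.sub n (len m))) (both (gapsNear (Nat.sub n (len m)) r' (len m))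
      (@List.rec (List ℕ) (fun _ => Bool) true
        (fun m' r'' _ => gapSumsNear (Nat.sub n (len m')) r'' (len m) (len m')) r'))) r

/-- Necessary conditions for appending the letter `a` to the word `l`, where equal letters are at
distance at least `h`. -/
noncomputable def admissible (h a : ℕ) (l : List ℕ) : Bool :=
  both (gapsBalanced h (len l) (occurrences a l)) (noRepetition l (occurrences a l))

/-- Whether all admissible extensions of `l` by one of the letters `cs`, at most `used`, satisfy
the test `t`, which is also given the new number of used letters. -/
noncomputable def testExtensions (h used : ℕ) (l : List ℕ) (t : ℕ → List ℕ → Bool)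
    (cs : List ℕ) : Bool :=
  @List.rec ℕ (fun _ => Bool) true (fun a _ ih =>
    @Bool.rec (fun _ => Bool)
      ih
      (@Bool.rec (fun _ => Bool)
        ih
        (both (@Bool.rec (fun _ => Bool) (t used (a :: l)) (t (Nat.succ used) (a :: l))
          (Nat.beq a used)) ih)
        (admissible h a l))
      (Nat.ble a used)) cs

/-- Backtracking search: `true` if no sequence of admissible extensions of `l` adds `k` letters,
where `l` uses only letters below `used` and new letters are introduced in increasing order. -/
noncomputable def exhausts (h k : ℕ) : ℕ → List ℕ → Bool :=
  @Nat.rec (fun _ => ℕ → List ℕ → Bool) (fun _ _ => false) (fun _ ih used l =>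
    testExtensions h used l ih [nat_lit 0, nat_lit 1, nat_lit 2, nat_lit 3, nat_lit 4]) k

theorem exhausts_gap_three :
    exhausts (nat_lit 0) (nat_lit 41) (nat_lit 3) [nat_lit 0, nat_lit 2, nat_lit 1, nat_lit 0] =
      true := by
  decide +kernel

theorem exhausts_gap_four : exhausts (nat_lit 4) (nat_lit 45) (nat_lit 0) [] = true := by
  decide +kernel

theorem both_eq_true {x y : Bool} : both x y = true ↔ x = true ∧ y = true := by
  cases x <;> cases y <;> decide

theorem len_initial (f : ℕ → ℕ) (n : ℕ) : len (initial f n) = n := by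
  induction n with
  | zero => rfl
  | succ n ih => exact congrArg Nat.succ ih

theorem agree_cons_cons (x y : ℕ) (l m : List ℕ) (n : ℕ) :
    agree (x :: l) (y :: m) (n + 1) = both (Nat.beq x y) (agree l m n) := rfl

theorem agree_nil_succ (l : List ℕ) (n : ℕ) : agree l [] (n + 1) = false := by
  cases l <;> rfl

theorem agree_nil_left_succ (l : List ℕ) (n : ℕ) : agree [] l (n + 1) = false := rfl

theorem eq_of_agree {f : ℕ → ℕ} {n m k : ℕ} (h : agree (initial f n) (initial f m) k = true) :
    k ≤ n ∧ k ≤ m ∧ ∀ j < k, f (n - k + j) = f (m - k + j) := by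
  induction k generalizing n m with
  | zero => simp
  | succ k ih =>
    rcases n with _ | n
    · simp [initial, agree_nil_left_succ] at h
    rcases m with _ | m
    · simp [initial, agree_nil_succ] at h
    rw [initial, initial, agree_cons_cons, both_eq_true] at h
    obtain ⟨hnm, hk⟩ := h
    obtain ⟨hn, hm, hj⟩ := ih hk
    refine ⟨by lia, by lia, fun j hjk => ?_⟩
    rw [Nat.add_sub_add_right, Nat.add_sub_add_right]
    rcases Nat.lt_succ_iff_lt_or_eq.mp hjk with h' | rfl
    · exact hj j h'
    · rw [Nat.sub_add_cancel hn, Nat.sub_add_cancel hm]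
      exact Nat.eq_of_beq_eq_true hnm

theorem beq_eq_false_of_ne {x y : ℕ} (h : x ≠ y) : Nat.beq x y = false :=
  Bool.eq_false_iff.mpr fun e => h (Nat.eq_of_beq_eq_true e)

theorem occurrences_cons_self (b : ℕ) (l : List ℕ) :
    occurrences b (b :: l) = l :: occurrences b l := by
  change @Bool.rec (fun _ => List (List ℕ)) _ _ (Nat.beq b b) = _
  rw [Nat.beq_refl]
  rfl

theorem occurrences_cons_of_ne {b x : ℕ} (h : x ≠ b) (l : List ℕ) :
    occurrences b (x :: l) = occurrences b l := by
  change @Bool.rec (fun _ => List (List ℕ)) _ _ (Nat.beq x b) = _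
  rw [beq_eq_false_of_ne h]
  rfl

/-- The positions `i < j` carry the letter `b`, with no `b` in between. -/
def Consecutive (f : ℕ → ℕ) (b i j : ℕ) : Prop :=
  i < j ∧ f i = b ∧ f j = b ∧ ∀ k, i < k → k < j → f k ≠ b

theorem occurrences_initial {f : ℕ → ℕ} {b n : ℕ} {m : List ℕ} {r : List (List ℕ)}
    (h : occurrences b (initial f n) = m :: r) :
    ∃ i < n, m = initial f i ∧ f i = b ∧ r = occurrences b (initial f i) ∧
      ∀ k, i < k → k < n → f k ≠ b := by
  induction n with
  | zero => simp [initial, occurrences] at h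
  | succ n ih =>
    rw [initial] at h
    by_cases hb : f n = b
    · rw [hb, occurrences_cons_self] at h
      obtain ⟨rfl, rfl⟩ := List.cons.inj h
      exact ⟨n, by lia, rfl, hb, rfl, fun k _ _ => by lia⟩
    · rw [occurrences_cons_of_ne hb] at h
      obtain ⟨i, hi, hm, hf, hr, hk⟩ := ih h
      refine ⟨i, by lia, hm, hf, hr, fun k hik hkn => ?_⟩
      rcases Nat.lt_succ_iff_lt_or_eq.mp hkn with h' | rfl
      · exact hk k hik h'
      · exact hb

theorem near_eq_true {x y : ℕ} (h₁ : x ≤ y + 1) (h₂ : y ≤ x + 1) : near x y = true :=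
  both_eq_true.mpr ⟨Nat.ble_eq_true_of_le h₁, Nat.ble_eq_true_of_le h₂⟩

theorem gapsNear_occurrences {f : ℕ → ℕ} {b g p : ℕ} (hp : f p = b)
    (h : ∀ i j, Consecutive f b i j → near g (j - i) = true) :
    gapsNear g (occurrences b (initial f p)) p = true := by
  generalize hr : occurrences b (initial f p) = r
  induction r generalizing p with
  | nil => rfl
  | cons m r ih =>
    obtain ⟨i, hip, rfl, hi, rfl, hk⟩ := occurrences_initial hr
    change both (near g (p - len _)) (gapsNear g _ (len _)) = true
    rw [len_initial, both_eq_true]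
    exact ⟨h i p ⟨hip, hi, hp, hk⟩, ih hi rfl⟩

theorem gapSumsNear_occurrences {f : ℕ → ℕ} {b g p q : ℕ} (hpq : Consecutive f b q p)
    (h : ∀ i j k, Consecutive f b i j → Consecutive f b j k → near g (k - i) = true) :
    gapSumsNear g (occurrences b (initial f q)) p q = true := by
  generalize hr : occurrences b (initial f q) = r
  induction r generalizing p q with
  | nil => rfl
  | cons m r ih =>
    obtain ⟨i, hiq, rfl, hi, rfl, hk⟩ := occurrences_initial hr
    have hc : Consecutive f b i q := ⟨hiq, hi, hpq.2.1, hk⟩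
    change both (near g (p - len _)) (gapSumsNear g _ q (len _)) = true
    rw [len_initial, both_eq_true]
    exact ⟨h i q p hc hpq, ih hc rfl⟩

/-- The word `f` is balanced, has no factor of exponent at least `3 / 2`, and equal letters are at
distance at least `h`. -/
structure Avoids {α : Type*} [DecidableEq α] (h : ℕ) (f : ℕ → α) : Prop where
  balanced : ∀ b i i' n, ((Finset.range n).filter fun j => f (i + j) = b).card ≤
    ((Finset.range n).filter fun j => f (i' + j) = b).card + 1
  exponent : ∀ i p k, 1 ≤ p → p ≤ 2 * k → ∃ j < k, f (i + j) ≠ f (i + j + p)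
  gap : ∀ i p, 1 ≤ p → f i = f (i + p) → h ≤ p

theorem Avoids.shift {α : Type*} [DecidableEq α] {h : ℕ} {f : ℕ → α} (hf : Avoids h f) (s : ℕ) :
    Avoids h fun j => f (s + j) where
  balanced b i i' n := by simpa only [add_assoc] using hf.balanced b (s + i) (s + i') n
  exponent i p k hp hk := by simpa only [add_assoc] using hf.exponent (s + i) p k hp hk
  gap i p hp e := hf.gap (s + i) p hp (by simpa only [add_assoc] using e)

theorem Avoids.comp {α β : Type*} [DecidableEq α] [DecidableEq β] {h : ℕ} {f : ℕ → α}
    (hf : Avoids h f) {g : α → β} (hg : g.Injective) : Avoids h (g ∘ f) where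
  balanced b i i' n := by
    by_cases hb : ∃ a, g a = b
    · obtain ⟨a, rfl⟩ := hb
      simpa only [Function.comp_apply, hg.eq_iff] using hf.balanced a i i' n
    · rw [Finset.filter_false_of_mem (p := fun j => (g ∘ f) (i + j) = b) fun j _ e => hb ⟨_, e⟩]
      simp
  exponent i p k hp hk := by
    simpa only [Function.comp_apply, hg.ne_iff] using hf.exponent i p k hp hk
  gap i p hp e := hf.gap i p hp (hg e)

theorem Avoids.gap_le {h : ℕ} {f : ℕ → ℕ} (hf : Avoids h f) {b i j i' j' : ℕ}
    (hij : Consecutive f b i j) (hij' : Consecutive f b i' j') : j - i ≤ j' - i' + 1 := by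
  obtain ⟨hlt, -, -, hne⟩ := hij
  obtain ⟨hlt', hi', hj', -⟩ := hij'
  by_contra! hc
  have hbal := hf.balanced b i' (i + 1) (j' - i' + 1)
  have hsub : ({0, j' - i'} : Finset ℕ) ⊆
      (Finset.range (j' - i' + 1)).filter fun k => f (i' + k) = b := by
    intro k hk
    simp only [Finset.mem_insert, Finset.mem_singleton] at hk
    rcases hk with rfl | rfl
    · simp [hi']
    · simp [Nat.add_sub_cancel' hlt'.le, hj']
  have hcard := Finset.card_le_card hsub
  rw [Finset.card_pair (by lia)] at hcard
  rw [Finset.filter_false_of_mem (s := Finset.range _) (p := fun k => f (i + 1 + k) = b)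
    fun k hk => hne _ (by lia) (by rw [Finset.mem_range] at hk; lia), Finset.card_empty] at hbal
  lia

theorem Avoids.gap_sum_le {h : ℕ} {f : ℕ → ℕ} (hf : Avoids h f) {b i j k i' j' k' : ℕ}
    (hij : Consecutive f b i j) (hjk : Consecutive f b j k)
    (hij' : Consecutive f b i' j') (hjk' : Consecutive f b j' k') : k - i ≤ k' - i' + 1 := by
  obtain ⟨hlt, -, -, hne⟩ := hij
  obtain ⟨hlt₂, -, -, hne₂⟩ := hjk
  obtain ⟨hlt', hi', hj', -⟩ := hij'
  obtain ⟨hlt₂', -, hk', -⟩ := hjk'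
  by_contra! hc
  have hbal := hf.balanced b i' (i + 1) (k' - i' + 1)
  have hsub : ({0, j' - i', k' - i'} : Finset ℕ) ⊆
      (Finset.range (k' - i' + 1)).filter fun k => f (i' + k) = b := by
    intro x hx
    simp only [Finset.mem_insert, Finset.mem_singleton] at hx
    rw [Finset.mem_filter, Finset.mem_range]
    rcases hx with rfl | rfl | rfl
    · exact ⟨by lia, hi'⟩
    · exact ⟨by lia, by rwa [Nat.add_sub_cancel' hlt'.le]⟩
    · exact ⟨by lia, by rwa [Nat.add_sub_cancel' (hlt'.trans hlt₂').le]⟩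
  have hsub' : ((Finset.range (k' - i' + 1)).filter fun x => f (i + 1 + x) = b) ⊆
      {j - (i + 1)} := by
    intro x hx
    rw [Finset.mem_filter, Finset.mem_range] at hx
    rw [Finset.mem_singleton]
    have h₁ : j ≤ i + 1 + x := by
      by_contra! hlt
      exact hne _ (by lia) hlt hx.2
    have h₂ : i + 1 + x ≤ j := by
      by_contra! hlt
      exact hne₂ _ hlt (by lia) hx.2
    lia
  have hcard := Finset.card_le_card hsub
  have hcard' := Finset.card_le_card hsub'
  rw [Finset.card_eq_three.mpr ⟨_, _, _, by lia, by lia, by lia, rfl⟩] at hcard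
  rw [Finset.card_singleton] at hcard'
  lia

theorem Avoids.gapsBalanced {h : ℕ} {f : ℕ → ℕ} (hf : Avoids h f) (n : ℕ) :
    gapsBalanced h n (occurrences (f n) (initial f n)) = true := by
  rcases hr : occurrences (f n) (initial f n) with _ | ⟨m, r⟩
  · rfl
  obtain ⟨i, hin, rfl, hi, rfl, hne⟩ := occurrences_initial hr
  have hc : Consecutive f (f n) i n := ⟨hin, hi, rfl, hne⟩
  refine both_eq_true.mpr ⟨?_, both_eq_true.mpr ⟨?_, ?_⟩⟩
  · rw [len_initial]
    exact Nat.ble_eq_true_of_le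
      (hf.gap i (n - i) (by lia) (by rw [Nat.add_sub_cancel' hin.le, hi]))
  · rw [len_initial]
    exact gapsNear_occurrences hi fun i' j' hc' =>
      near_eq_true (hf.gap_le hc hc') (hf.gap_le hc' hc)
  · rcases hr' : occurrences (f n) (initial f i) with _ | ⟨m, r⟩
    · rfl
    obtain ⟨i₂, hi₂n, rfl, hi₂, rfl, hne₂⟩ := occurrences_initial hr'
    have hc₂ : Consecutive f (f n) i₂ i := ⟨hi₂n, hi₂, hi, hne₂⟩
    change gapSumsNear (n - len _) _ (len _) (len _) = true
    rw [len_initial, len_initial]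
    exact gapSumsNear_occurrences hc₂ fun i' j' k' hij hjk =>
      near_eq_true (hf.gap_sum_le hc₂ hc hij hjk) (hf.gap_sum_le hij hjk hc₂ hc)

theorem Avoids.noRepetition {h : ℕ} {f : ℕ → ℕ} (hf : Avoids h f) {n q : ℕ} (hq : q ≤ n) :
    noRepetition (initial f n) (occurrences (f n) (initial f q)) = true := by
  generalize hr : occurrences (f n) (initial f q) = r
  induction r generalizing q with
  | nil => rfl
  | cons m r ih =>
    obtain ⟨i, hiq, rfl, hi, rfl, -⟩ := occurrences_initial hr
    have hfalse : agree (initial f n) (initial f i) ((n - i - 1) / 2) = false := by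
      rw [Bool.eq_false_iff]
      intro hagree
      obtain ⟨-, hk, hj⟩ := eq_of_agree hagree
      generalize hk' : (n - i - 1) / 2 = k at hk hj
      obtain ⟨j, hjk, hne⟩ := hf.exponent (i - k) (n - i) (k + 1) (by lia) (by lia)
      rcases Nat.lt_succ_iff_lt_or_eq.mp hjk with h' | rfl
      · exact hne ((hj j h').symm.trans (congrArg f (by lia)))
      · apply hne
        rw [Nat.sub_add_cancel hk, hi, Nat.add_sub_cancel' (by lia)]
    change @Bool.rec (fun _ => Bool) (BalancedWord.noRepetition _ _) false
      (agree _ _ (((len _ - len _) - 1) / 2)) = true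
    rw [len_initial, len_initial, hfalse]
    exact ih (by lia) rfl

theorem Avoids.admissible {h : ℕ} {f : ℕ → ℕ} (hf : Avoids h f) (n : ℕ) :
    admissible h (f n) (initial f n) = true := by
  rw [BalancedWord.admissible, len_initial, both_eq_true]
  exact ⟨hf.gapsBalanced n, hf.noRepetition le_rfl⟩

theorem testExtensions_eq_true {h used a : ℕ} {l cs : List ℕ} {t : ℕ → List ℕ → Bool}
    (ht : testExtensions h used l t cs = true) (ha : a ∈ cs) (hu : a ≤ used)
    (hadm : admissible h a l = true) :
    t (if a = used then used + 1 else used) (a :: l) = true := by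
  induction cs with
  | nil => simp at ha
  | cons c cs ih =>
    change @Bool.rec (fun _ => Bool) (testExtensions h used l t cs)
      (@Bool.rec (fun _ => Bool) (testExtensions h used l t cs)
        (both (@Bool.rec (fun _ => Bool) (t used (c :: l)) (t (used + 1) (c :: l))
          (Nat.beq c used)) (testExtensions h used l t cs))
        (BalancedWord.admissible h c l))
      (Nat.ble c used) = true at ht
    rcases List.mem_cons.mp ha with rfl | ha
    · rw [hadm, Nat.ble_eq_true_of_le hu] at ht
      have ht' := (both_eq_true.mp ht).1
      split_ifs with hau
      · subst hau
        rwa [Nat.beq_refl] at ht'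
      · rwa [beq_eq_false_of_ne hau] at ht'
    · refine ih ?_ ha
      revert ht
      cases Nat.ble c used
      · exact id
      · cases BalancedWord.admissible h c l
        · exact id
        · exact fun ht => (both_eq_true.mp ht).2

/-- Up to renaming the letters, `l` is the reversed word of the first `n` letters of `w`, its letters are
below `used` and all letters are below `5`. -/
def Labels {α : Type*} (w : ℕ → α) (used n : ℕ) (l : List ℕ) : Prop :=
  ∃ g : α → ℕ, g.Injective ∧ (∀ a, g a < 5) ∧ (∀ x ∈ l, x < used) ∧ l = initial (g ∘ w) n

theorem initial_comp {α β : Type*} (g : α → β) (f : ℕ → α) (n : ℕ) :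
    initial (g ∘ f) n = (initial f n).map g := by
  induction n with
  | zero => rfl
  | succ n ih => simp [initial, ih]

theorem Labels.extend {α : Type*} [DecidableEq α] {w : ℕ → α} {h used n : ℕ} {l : List ℕ}
    (hw : Avoids h w) (hl : Labels w used n l) :
    ∃ a < 5, a ≤ used ∧ admissible h a l = true ∧
      Labels w (if a = used then used + 1 else used) (n + 1) (a :: l) := by
  obtain ⟨g, hg, hg5, hlu, rfl⟩ := hl
  have key : ∀ g : α → ℕ, g.Injective → (∀ a, g a < 5) → (∀ x ∈ initial (g ∘ w) n, x < used) →
      g (w n) ≤ used → ∃ a < 5, a ≤ used ∧ BalancedWord.admissible h a (initial (g ∘ w) n) =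
        true ∧ Labels w (if a = used then used + 1 else used) (n + 1) (a :: initial (g ∘ w) n) := by
    intro g hg hg5 hlu hle
    refine ⟨g (w n), hg5 _, hle, (hw.comp hg).admissible n, g, hg, hg5, fun x hx => ?_, rfl⟩
    rcases List.mem_cons.mp hx with rfl | hx
    · split_ifs <;> lia
    · have := hlu x hx
      split_ifs <;> lia
  rcases le_or_gt (g (w n)) used with hle | hlt
  · exact key g hg hg5 hlu hle
  · have heq : initial ((Equiv.swap (g (w n)) used ∘ g) ∘ w) n = initial (g ∘ w) n := by
      rw [Function.comp_assoc, initial_comp]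
      refine (List.map_congr_left fun x hx => ?_).trans (List.map_id _)
      have := hlu x hx
      exact Equiv.swap_apply_of_ne_of_ne (by lia) (by lia)
    rw [← heq]
    refine key _ ((Equiv.injective _).comp hg) (fun a => ?_) (heq ▸ hlu) ?_
    · have h₁ := hg5 a
      have h₂ := hg5 (w n)
      rw [Function.comp_apply, Equiv.swap_apply_def]
      split_ifs <;> lia
    · rw [Function.comp_apply, Equiv.swap_apply_left]

theorem Labels.not_exhausts {α : Type*} [DecidableEq α] {w : ℕ → α} {h used n k : ℕ} {l : List ℕ}
    (hw : Avoids h w) (hl : Labels w used n l) : exhausts h k used l = false := by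
  rw [Bool.eq_false_iff]
  intro hk
  induction k generalizing used n l with
  | zero => exact Bool.false_ne_true hk
  | succ k ih =>
    obtain ⟨a, ha, hu, hadm, hl'⟩ := hl.extend hw
    refine ih hl' (testExtensions_eq_true (cs := [0, 1, 2, 3, 4]) hk ?_ hu hadm)
    interval_cases a <;> simp

theorem labels_nil {α : Type*} [Fintype α] (hα : Fintype.card α ≤ 5) (w : ℕ → α) :
    Labels w 0 0 [] := by
  obtain ⟨g⟩ := Function.Embedding.nonempty_of_card_le (α := α) (β := Fin 5) (by simpa using hα)
  exact ⟨fun a => g a, Fin.val_injective.comp g.injective, fun a => (g a).2, by simp, rfl⟩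

theorem Avoids.ne_add_one {α : Type*} [DecidableEq α] {h : ℕ} {w : ℕ → α} (hw : Avoids h w)
    (i : ℕ) : w i ≠ w (i + 1) := by
  obtain ⟨j, hj, hne⟩ := hw.exponent i 1 1 le_rfl (by lia)
  rwa [Nat.lt_one_iff.mp hj] at hne

theorem Avoids.ne_add_two {α : Type*} [DecidableEq α] {h : ℕ} {w : ℕ → α} (hw : Avoids h w)
    (i : ℕ) : w i ≠ w (i + 2) := by
  obtain ⟨j, hj, hne⟩ := hw.exponent i 2 1 (by lia) le_rfl
  rwa [Nat.lt_one_iff.mp hj] at hne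

theorem Avoids.labels_gap_three {α : Type*} [DecidableEq α] [Fintype α]
    (hα : Fintype.card α ≤ 5) {h : ℕ} {w : ℕ → α} (hw : Avoids h w) (h3 : w 0 = w 3) :
    Labels w 3 4 [0, 2, 1, 0] := by
  have h01 := hw.ne_add_one 0
  have h12 := hw.ne_add_one 1
  have h02 := hw.ne_add_two 0
  obtain ⟨a, -, ha, -, hl₁⟩ := (labels_nil hα w).extend hw
  obtain rfl : a = 0 := by lia
  obtain ⟨b, -, hb, -, hl₂⟩ := hl₁.extend hw
  obtain rfl : b = 1 := by
    obtain ⟨g, hg, -, -, he⟩ := hl₂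
    simp only [initial, List.cons.injEq, Function.comp_apply] at he
    have := hg.ne h01
    simp only [zero_add] at this hb
    simp only [if_true] at hb
    lia
  obtain ⟨c, -, hc, -, hl₃⟩ := hl₂.extend hw
  obtain rfl : c = 2 := by
    obtain ⟨g, hg, -, -, he⟩ := hl₃
    simp only [initial, List.cons.injEq, Function.comp_apply] at he
    have h₁ := hg.ne h12
    have h₂ := hg.ne h02
    simp only [zero_add, Nat.reduceAdd, if_true] at h₁ h₂ hc he
    lia
  obtain ⟨d, -, -, -, hl₄⟩ := hl₃.extend hw
  obtain rfl : d = 0 := by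
    obtain ⟨g, -, -, -, he⟩ := hl₄
    simp only [initial, List.cons.injEq, Function.comp_apply] at he
    rw [← h3] at he
    lia
  simpa using hl₄

theorem not_avoids {α : Type*} [DecidableEq α] [Fintype α] (hα : Fintype.card α ≤ 5)
    (w : ℕ → α) : ¬Avoids 0 w := by
  intro hw
  by_cases h3 : ∃ i, w i = w (i + 3)
  · obtain ⟨i, hi⟩ := h3
    have hs := hw.shift i
    exact Bool.false_ne_true
      (((hs.labels_gap_three hα hi).not_exhausts hs).symm.trans exhausts_gap_three)
  · have hw4 : Avoids 4 w := by
      refine ⟨hw.balanced, hw.exponent, fun i p hp e => ?_⟩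
      by_contra! hlt
      interval_cases p
      · exact hw.ne_add_one i e
      · exact hw.ne_add_two i e
      · exact h3 ⟨i, e⟩
    exact Bool.false_ne_true (((labels_nil hα w).not_exhausts hw4).symm.trans exhausts_gap_four)

end BalancedWord

/-- Every infinite balanced word over an alphabet of at most 5 letters has critical
exponent at least `3/2`: for every rational `q < 3/2` there is a nonempty factor with
period `p ≥ 1` and exponent `n/p > q`. -/
theorem balanced_word_critical_exponent_ge_three_halves
    (A : Type) [Fintype A] [DecidableEq A] (hA : Fintype.card A ≤ 5)
    (w : ℕ → A)
    (hbal : ∀ (a : A) (i i' n : ℕ),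
      ((((Finset.range n).filter fun j => w (i + j) = a).card : ℤ) -
        (((Finset.range n).filter fun j => w (i' + j) = a).card : ℤ)).natAbs ≤ 1) :
    ∀ q : ℚ, q < 3 / 2 → ∃ i n p : ℕ, 1 ≤ n ∧ 1 ≤ p ∧
      (∀ j, j + p < n → w (i + j) = w (i + j + p)) ∧ q < (n : ℚ) / (p : ℚ) := by
  intro q hq
  by_contra! hno
  refine BalancedWord.not_avoids hA w ⟨fun b i i' n => ?_, fun i p k hp hk => ?_, by simp⟩
  · have := hbal b i i' n
    lia
  · by_contra! hper
    have hle := hno i (p + k) p (by lia) hp fun j hj => hper j (by lia)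
    have hp' : (0 : ℚ) < p := by exact_mod_cast hp
    have hk' : (p : ℚ) ≤ 2 * k := by exact_mod_cast hk
    have hge : (3 / 2 : ℚ) ≤ ((p + k : ℕ) : ℚ) / p := by
      rw [le_div_iff₀ hp']
      push_cast
      linarith
    linarith
end
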